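/- For every integer n ≥ 3, H(n,3) ≥ 2⌊(n−1)/4⌋ + ⌊(n−1)/2⌋; consequently also H(n,4) ≥ 2⌊(n−1)/4⌋ + ⌊(n−1)/2⌋. -/

import Mathlib

open Filter Polynomial

/-- `Γ` is a periodic orbit of the planar vector field `V`: the image of a
nonconstant periodic solution of `γ' = V ∘ γ`. -/
def IsPeriodicOrbit (V : ℝ × ℝ → ℝ × ℝ) (Γ : Set (ℝ × ℝ)) : Prop :=
  ∃ γ : ℝ → ℝ × ℝ,
    (∀ t : ℝ, HasDerivAt γ (V (γ t)) t) ∧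
    (∃ T : ℝ, 0 < T ∧ Function.Periodic γ T) ∧
    (∃ t₁ t₂ : ℝ, γ t₁ ≠ γ t₂) ∧
    Γ = Set.range γ

/-- `Γ` is a limit cycle of `V`: a periodic orbit which is isolated among
periodic orbits. -/
def IsLimitCycle (V : ℝ × ℝ → ℝ × ℝ) (Γ : Set (ℝ × ℝ)) : Prop :=
  IsPeriodicOrbit V Γ ∧
  ∃ U : Set (ℝ × ℝ), IsOpen U ∧ Γ ⊆ U ∧
    ∀ Γ' : Set (ℝ × ℝ), IsPeriodicOrbit V Γ' → Γ' ⊆ U → Γ' = Γ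

/-- The Liénard vector field `ẋ = y, ẏ = -g(x) - ε f(x) y`. -/
def lienard (f g : Polynomial ℝ) (ε : ℝ) : ℝ × ℝ → ℝ × ℝ :=
  fun p => (p.2, -(g.eval p.1) - ε * (f.eval p.1) * p.2)

/-- `HGe n m c` formalizes `H(n,m) ≥ c`: there are polynomials `f, g` with
`deg f ≤ n`, `deg g ≤ m` and `ε₀ > 0` such that for every `0 < ε ≤ ε₀` the
Liénard system has at least `c` pairwise distinct limit cycles. -/
def HGe (n m : ℕ) (c : ℝ) : Prop :=
  ∃ f g : Polynomial ℝ, f.natDegree ≤ n ∧ g.natDegree ≤ m ∧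
    ∃ ε₀ : ℝ, 0 < ε₀ ∧ ∀ ε : ℝ, 0 < ε → ε ≤ ε₀ →
      ∃ S : Finset (Set (ℝ × ℝ)),
        (∀ Γ ∈ S, IsLimitCycle (lienard f g ε) Γ) ∧ c ≤ (S.card : ℝ)

section AveragingMethod

open Set Topology MeasureTheory
open scoped NNReal

theorem eventually_forall_abs_sub_lt {X : Type*} [TopologicalSpace X] {F : X × ℝ → ℝ} {p₀ : X}
    {a b : ℝ} (hF : ∀ θ ∈ Icc a b, ContinuousAt F (p₀, θ)) {κ : ℝ} (hκ : 0 < κ) :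
    ∀ᶠ p in 𝓝 p₀, ∀ θ ∈ Icc a b, |F (p, θ) - F (p₀, θ)| < κ := by
  refine isCompact_Icc.eventually_forall_of_forall_eventually fun θ hθ => ?_
  have h1 : ContinuousAt (fun z : X × ℝ => |F (z.1, z.2) - F (p₀, z.2)|) (p₀, θ) := by
    have h2 : ContinuousAt (fun z : X × ℝ => F (p₀, z.2)) (p₀, θ) :=
      ContinuousAt.comp (f := fun z : X × ℝ => (p₀, z.2)) (hF θ hθ) (by fun_prop)
    exact ((hF θ hθ).sub h2).abs
  exact h1.eventually_lt_const (by simpa using hκ)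

theorem continuousOn_slice {X : Type*} [TopologicalSpace X] {F : X × ℝ → ℝ} {p : X} {s : Set ℝ}
    (hF : ∀ θ ∈ s, ContinuousAt F (p, θ)) : ContinuousOn (fun θ => F (p, θ)) s := fun θ hθ =>
  (ContinuousAt.comp (f := fun θ : ℝ => (p, θ)) (hF θ hθ) (by fun_prop)).continuousWithinAt

theorem continuousAt_integral_slice {X : Type*} [TopologicalSpace X] [FirstCountableTopology X]
    {F : X × ℝ → ℝ} {p₀ : X} {a b : ℝ} (hab : a ≤ b)
    (hF : ∀ᶠ p in 𝓝 p₀, ∀ θ ∈ Icc a b, ContinuousAt F (p, θ)) :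
    ContinuousAt (fun p => ∫ θ in a..b, F (p, θ)) p₀ := by
  have h0 := hF.self_of_nhds
  have hc : ∀ p, (∀ θ ∈ Icc a b, ContinuousAt F (p, θ)) →
      IntervalIntegrable (fun θ => F (p, θ)) volume a b := fun p hp =>
    (by rw [uIcc_of_le hab]; exact continuousOn_slice hp : ContinuousOn (fun θ => F (p, θ))
      (uIcc a b)).intervalIntegrable
  refine intervalIntegral.continuousAt_of_dominated_interval
    (bound := fun θ => |F (p₀, θ)| + 1) ?_ ?_ ?_ ?_
  · filter_upwards [hF] with p hp
    exact (intervalIntegrable_iff.1 (hc p hp)).aestronglyMeasurable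
  · filter_upwards [eventually_forall_abs_sub_lt h0 one_pos] with p hp
    refine Eventually.of_forall fun θ hθ => ?_
    rw [uIoc_of_le hab] at hθ
    have := hp θ (Ioc_subset_Icc_self hθ)
    rw [Real.norm_eq_abs]
    have := abs_sub_abs_le_abs_sub (F (p, θ)) (F (p₀, θ))
    linarith
  · exact (hc p₀ h0).abs.add (by simp)
  · refine Eventually.of_forall fun θ hθ => ?_
    rw [uIoc_of_le hab] at hθ
    exact ContinuousAt.comp (f := fun p => (p, θ)) (h0 θ (Ioc_subset_Icc_self hθ)) (by fun_prop)

/-- The partial derivative of `F` in the second component of its parameter. -/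
noncomputable def radialDeriv (F : (ℝ × ℝ) × ℝ → ℝ) (q : (ℝ × ℝ) × ℝ) : ℝ :=
  fderiv ℝ F q ((0, 1), 0)

theorem hasDerivAt_radial {F : (ℝ × ℝ) × ℝ → ℝ} {δ r θ : ℝ}
    (hF : ContDiffAt ℝ 1 F ((δ, r), θ)) :
    HasDerivAt (fun x => F ((δ, x), θ)) (radialDeriv F ((δ, r), θ)) r := by
  have h1 : HasDerivAt (fun x : ℝ => (((δ, x), θ) : (ℝ × ℝ) × ℝ)) ((0, 1), 0) r :=
    ((hasDerivAt_const r δ).prodMk (hasDerivAt_id r)).prodMk (hasDerivAt_const r θ)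
  exact (hF.differentiableAt one_ne_zero).hasFDerivAt.comp_hasDerivAt r h1

theorem continuousAt_radialDeriv {F : (ℝ × ℝ) × ℝ → ℝ} {q : (ℝ × ℝ) × ℝ}
    (hF : ContDiffAt ℝ 1 F q) : ContinuousAt (radialDeriv F) q := by
  have h := (hF.fderiv_right (m := 0) (by norm_num)).continuousAt
  exact h.clm_apply continuousAt_const

theorem eventually_forall_contDiffAt {F : (ℝ × ℝ) × ℝ → ℝ} {p₀ : ℝ × ℝ} {a b : ℝ}
    (hF : ∀ θ ∈ Icc a b, ContDiffAt ℝ 1 F (p₀, θ)) :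
    ∀ᶠ p in 𝓝 p₀, ∀ θ ∈ Icc a b, ContDiffAt ℝ 1 F (p, θ) :=
  isCompact_Icc.eventually_forall_of_forall_eventually fun θ hθ =>
    (hF θ hθ).eventually (by simp)

theorem hasDerivAt_integral_slice {F : (ℝ × ℝ) × ℝ → ℝ} {δ r a b : ℝ} (hab : a ≤ b)
    (hF : ∀ θ ∈ Icc a b, ContDiffAt ℝ 1 F ((δ, r), θ)) :
    HasDerivAt (fun x => ∫ θ in a..b, F ((δ, x), θ))
      (∫ θ in a..b, radialDeriv F ((δ, r), θ)) r := by
  have hc : ∀ G : (ℝ × ℝ) × ℝ → ℝ, ∀ p, (∀ θ ∈ Icc a b, ContinuousAt G (p, θ)) →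
      IntervalIntegrable (fun θ => G (p, θ)) volume a b := fun G p hp =>
    (by rw [uIcc_of_le hab]; exact continuousOn_slice hp : ContinuousOn (fun θ => G (p, θ))
      (uIcc a b)).intervalIntegrable
  have hR : ∀ θ ∈ Icc a b, ContinuousAt (radialDeriv F) ((δ, r), θ) := fun θ hθ =>
    continuousAt_radialDeriv (hF θ hθ)
  have hcur : ContinuousAt (fun x : ℝ => (δ, x)) r := by fun_prop
  have hev : ∀ᶠ x in 𝓝 r, ∀ θ ∈ Icc a b, ContDiffAt ℝ 1 F ((δ, x), θ) :=
    hcur.eventually (eventually_forall_contDiffAt hF)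
  have hev2 : ∀ᶠ x in 𝓝 r, ∀ θ ∈ Icc a b,
      |radialDeriv F ((δ, x), θ) - radialDeriv F ((δ, r), θ)| < 1 :=
    hcur.eventually (eventually_forall_abs_sub_lt hR one_pos)
  refine (intervalIntegral.hasDerivAt_integral_of_dominated_loc_of_deriv_le
    (F := fun x θ => F ((δ, x), θ)) (F' := fun x θ => radialDeriv F ((δ, x), θ))
    (bound := fun θ => |radialDeriv F ((δ, r), θ)| + 1)
    (hev.and hev2) ?_ ?_ ?_ ?_ ?_ ?_).2
  · filter_upwards [hev] with x hx
    exact (intervalIntegrable_iff.1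
      (hc F _ fun θ hθ => (hx θ hθ).continuousAt)).aestronglyMeasurable
  · exact hc F _ fun θ hθ => (hF θ hθ).continuousAt
  · exact (intervalIntegrable_iff.1 (hc _ _ hR)).aestronglyMeasurable
  · refine Eventually.of_forall fun θ hθ x hx => ?_
    rw [uIoc_of_le hab] at hθ
    have := hx.2 θ (Ioc_subset_Icc_self hθ)
    rw [Real.norm_eq_abs]
    have := abs_sub_abs_le_abs_sub (radialDeriv F ((δ, x), θ)) (radialDeriv F ((δ, r), θ))
    linarith
  · exact (hc _ _ hR).abs.add (by simp)
  · refine Eventually.of_forall fun θ hθ x hx => ?_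
    rw [uIoc_of_le hab] at hθ
    exact hasDerivAt_radial (hx.1 θ (Ioc_subset_Icc_self hθ))

/-- A simple zero of a function on the line changes its sign. -/
theorem eventually_sign_of_hasDerivAt {M : ℝ → ℝ} {r d : ℝ} (h0 : M r = 0)
    (hM : HasDerivAt M d r) (hd : 0 < d) :
    ∀ᶠ η in 𝓝[>] (0 : ℝ), M (r - η) < 0 ∧ 0 < M (r + η) := by
  have h1 := hM.isLittleO.def (c := d / 2) (by positivity)
  have ha : Tendsto (fun η : ℝ => r - η) (𝓝[>] 0) (𝓝 r) := by
    have : Tendsto (fun η : ℝ => r - η) (𝓝 0) (𝓝 (r - 0)) := by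
      apply Continuous.tendsto; fun_prop
    rw [sub_zero] at this
    exact this.mono_left nhdsWithin_le_nhds
  have hb : Tendsto (fun η : ℝ => r + η) (𝓝[>] 0) (𝓝 r) := by
    have : Tendsto (fun η : ℝ => r + η) (𝓝 0) (𝓝 (r + 0)) := by
      apply Continuous.tendsto; fun_prop
    rw [add_zero] at this
    exact this.mono_left nhdsWithin_le_nhds
  filter_upwards [ha.eventually h1, hb.eventually h1, self_mem_nhdsWithin] with η h2 h3 h4
  have h4' : 0 < η := h4
  simp only [h0, smul_eq_mul, Real.norm_eq_abs] at h2 h3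
  rw [show r - η - r = -η by ring, abs_neg, abs_of_pos h4', abs_le] at h2
  rw [show r + η - r = η by ring, abs_of_pos h4', abs_le] at h3
  constructor <;> nlinarith [mul_pos hd h4', h2.1, h2.2, h3.1, h3.2]

theorem exists_simple_zero_of_pos {F : (ℝ × ℝ) × ℝ → ℝ} {r₀ d a b : ℝ} (hab : a ≤ b)
    (hF : ∀ θ ∈ Icc a b, ContDiffAt ℝ 1 F ((0, r₀), θ))
    (h0 : ∫ θ in a..b, F ((0, r₀), θ) = 0)
    (hd : HasDerivAt (fun x => ∫ θ in a..b, F ((0, x), θ)) d r₀) (hd0 : 0 < d)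
    {η : ℝ} (hη : 0 < η) :
    ∀ᶠ δ in 𝓝 (0 : ℝ), ∃ r, |r - r₀| < η ∧ ∫ θ in a..b, F ((δ, r), θ) = 0 ∧
      ∃ d', 0 < d' ∧ HasDerivAt (fun x => ∫ θ in a..b, F ((δ, x), θ)) d' r := by
  have hev := eventually_forall_contDiffAt hF
  have hN : ContinuousAt (fun p : ℝ × ℝ => ∫ θ in a..b, radialDeriv F (p, θ)) (0, r₀) := by
    refine continuousAt_integral_slice hab ?_
    filter_upwards [hev] with p hp θ hθ using continuousAt_radialDeriv (hp θ hθ)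
  have hN0 : ∫ θ in a..b, radialDeriv F ((0, r₀), θ) = d :=
    (hasDerivAt_integral_slice hab hF).unique hd
  have hpos : ∀ᶠ p in 𝓝 ((0 : ℝ), r₀), 0 < ∫ θ in a..b, radialDeriv F (p, θ) :=
    hN.eventually_const_lt (hd0.trans_eq hN0.symm)
  obtain ⟨τ, hτ, hball⟩ := Metric.eventually_nhds_iff.1 (hev.and hpos)
  have hball' : ∀ δ x, |δ| < τ → |x - r₀| < τ → (∀ θ ∈ Icc a b, ContDiffAt ℝ 1 F ((δ, x), θ)) ∧
      0 < ∫ θ in a..b, radialDeriv F ((δ, x), θ) := fun δ x h1 h2 => by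
    refine hball ?_
    rw [Prod.dist_eq, Real.dist_eq, Real.dist_eq]
    simpa using ⟨h1, h2⟩
  obtain ⟨ζ, ⟨hs, hζ⟩, hζ0⟩ := ((eventually_sign_of_hasDerivAt (M := fun x => ∫ θ in a..b, F ((0, x), θ)) h0 hd hd0).and
    ((eventually_lt_nhds (lt_min hτ hη)).filter_mono nhdsWithin_le_nhds) |>.and
      self_mem_nhdsWithin).exists
  have hζ0 : 0 < ζ := hζ0
  obtain ⟨hζτ, hζη⟩ := lt_min_iff.1 hζ
  have hcont : ∀ x, |x - r₀| < τ → ContinuousAt (fun δ => ∫ θ in a..b, F ((δ, x), θ)) 0 := by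
    intro x hx
    have h1 := (hball' 0 x (by simpa using hτ) hx).1
    have h2 : ContinuousAt (fun p : ℝ × ℝ => ∫ θ in a..b, F (p, θ)) (0, x) := by
      refine continuousAt_integral_slice hab ?_
      filter_upwards [eventually_forall_contDiffAt h1] with p hp θ hθ using
        (hp θ hθ).continuousAt
    exact ContinuousAt.comp (f := fun δ : ℝ => (δ, x)) h2 (by fun_prop)
  have e1 : |r₀ - ζ - r₀| < τ := by
    rw [show r₀ - ζ - r₀ = -ζ by ring, abs_neg, abs_of_pos hζ0]; exact hζτ
  have e2 : |r₀ + ζ - r₀| < τ := by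
    rw [show r₀ + ζ - r₀ = ζ by ring, abs_of_pos hζ0]; exact hζτ
  filter_upwards [(hcont _ e1).eventually_lt_const hs.1, (hcont _ e2).eventually_const_lt hs.2,
    Metric.ball_mem_nhds (0 : ℝ) hτ] with δ h1 h2 h3
  have h3 : |δ| < τ := by simpa using h3
  have hder : ∀ x ∈ Icc (r₀ - ζ) (r₀ + ζ), 0 < ∫ θ in a..b, radialDeriv F ((δ, x), θ) ∧
      HasDerivAt (fun x => ∫ θ in a..b, F ((δ, x), θ))
      (∫ θ in a..b, radialDeriv F ((δ, x), θ)) x := by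
    intro x hx
    have h4 := hball' δ x h3 (by rw [abs_lt]; constructor <;> linarith [hx.1, hx.2])
    exact ⟨h4.2, hasDerivAt_integral_slice hab h4.1⟩
  obtain ⟨r, hr, hr0⟩ := intermediate_value_Icc (f := fun x => ∫ θ in a..b, F ((δ, x), θ)) (by linarith : r₀ - ζ ≤ r₀ + ζ)
    (fun x hx => (hder x hx).2.continuousAt.continuousWithinAt) (⟨h1.le, h2.le⟩ :
      (0 : ℝ) ∈ Icc _ _)
  exact ⟨r, by rw [abs_lt]; constructor <;> linarith [hr.1, hr.2], hr0, _, hder r hr⟩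

/-- Simple zeros of an averaged function persist under small changes of a parameter. -/
theorem exists_simple_zero {F : (ℝ × ℝ) × ℝ → ℝ} {r₀ d a b : ℝ} (hab : a ≤ b)
    (hF : ∀ θ ∈ Icc a b, ContDiffAt ℝ 1 F ((0, r₀), θ))
    (h0 : ∫ θ in a..b, F ((0, r₀), θ) = 0)
    (hd : HasDerivAt (fun x => ∫ θ in a..b, F ((0, x), θ)) d r₀) (hd0 : d ≠ 0)
    {η : ℝ} (hη : 0 < η) :
    ∀ᶠ δ in 𝓝 (0 : ℝ), ∃ r, |r - r₀| < η ∧ ∫ θ in a..b, F ((δ, r), θ) = 0 ∧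
      ∃ d', d' ≠ 0 ∧ HasDerivAt (fun x => ∫ θ in a..b, F ((δ, x), θ)) d' r := by
  rcases hd0.lt_or_gt with hd0 | hd0
  · have h := exists_simple_zero_of_pos (F := fun q => -F q) hab (fun θ hθ => (hF θ hθ).neg)
      (by simpa using h0)
      (hd.fun_neg.congr_of_eventuallyEq (by simp)) (neg_pos.2 hd0) hη
    filter_upwards [h] with δ ⟨r, h1, h2, d', h3, h4⟩
    exact ⟨r, h1, by simpa using h2, -d', by simpa using h3.ne', by simpa using h4.fun_neg⟩
  · filter_upwards [exists_simple_zero_of_pos hab hF h0 hd hd0 hη] with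
      δ ⟨r, h1, h2, d', h3, h4⟩ using ⟨r, h1, h2, d', h3.ne', h4⟩

/-- A periodic function whose square grows over each period vanishes. -/
theorem eq_zero_of_periodic_of_growth {w w' b : ℝ → ℝ} {T : ℝ} {k : ℕ} (hk : 1 ≤ k) (hT : 0 ≤ T)
    (hw : ∀ θ, HasDerivAt w (w' θ) θ) (hb : Continuous b) (hbT : Function.Periodic b T)
    (hpos : 0 < ∫ θ in (0 : ℝ)..T, b θ) (hgrow : ∀ θ, b θ * w θ ^ 2 ≤ w θ * w' θ)
    (hper : Function.Periodic w (k * T)) (θ : ℝ) : w θ = 0 := by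
  set B : ℝ → ℝ := fun θ => ∫ x in (0 : ℝ)..θ, b x with hB
  have hBd : ∀ θ, HasDerivAt B (b θ) θ := fun θ => hb.integral_hasStrictDerivAt 0 θ |>.hasDerivAt
  have hZ : ∀ θ, HasDerivAt (fun θ => w θ ^ 2 * Real.exp (-2 * B θ))
      (2 * (w θ * w' θ - b θ * w θ ^ 2) * Real.exp (-2 * B θ)) θ := fun θ => by
    refine (((hw θ).fun_pow 2).fun_mul ((hBd θ).const_mul (-2)).exp).congr_deriv ?_
    push_cast
    ring
  have hmono : Monotone fun θ => w θ ^ 2 * Real.exp (-2 * B θ) := by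
    refine monotone_of_hasDerivAt_nonneg hZ fun θ => ?_
    have := hgrow θ
    have := Real.exp_pos (-2 * B θ)
    simp only [Pi.zero_apply]
    exact mul_nonneg (by linarith) this.le
  have hint : ∀ t₁ t₂, IntervalIntegrable b volume t₁ t₂ := fun _ _ => hb.intervalIntegrable _ _
  have hk' : (1 : ℝ) ≤ k := by exact_mod_cast hk
  have hBk : B (θ + k * T) = B θ + k * ∫ x in (0 : ℝ)..T, b x := by
    have h1 := hbT.intervalIntegral_add_zsmul_eq (k : ℤ) θ hint
    have h2 := hbT.intervalIntegral_add_eq θ 0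
    simp only [zsmul_eq_mul, Int.cast_natCast, zero_add] at h1 h2
    rw [h2] at h1
    have h3 := intervalIntegral.integral_add_adjacent_intervals (hint 0 θ) (hint θ (θ + k * T))
    rw [h1] at h3
    exact h3.symm
  have h1 : θ ≤ θ + k * T := by nlinarith
  have h2 := hmono h1
  simp only [hBk, hper θ] at h2
  by_contra hne
  have h3 : 0 < w θ ^ 2 := by positivity
  have h4 := Real.exp_lt_exp.2 (by nlinarith : -2 * (B θ + k * ∫ x in (0 : ℝ)..T, b x) < -2 * B θ)
  nlinarith

/-- Existence of a periodic solution of a bounded periodic scalar equation whose mean has opposite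
signs near two initial values. -/
theorem exists_periodic_solution {f : ℝ → ℝ → ℝ} {K L : ℝ≥0} {T lo hi s : ℝ} (hT : 0 < T)
    (hlohi : lo ≤ hi) (hf : Continuous fun q : ℝ × ℝ => f q.1 q.2)
    (hlip : ∀ θ, LipschitzWith K (f θ)) (hL : ∀ θ x, |f θ x| ≤ L)
    (hper : ∀ θ x, f (θ + T) x = f θ x)
    (hlo : ∀ β : ℝ → ℝ, ContinuousOn β (Icc 0 T) → (∀ θ ∈ Icc 0 T, |β θ - lo| ≤ L * T) →
      s * ∫ θ in (0 : ℝ)..T, f θ (β θ) < 0)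
    (hhi : ∀ β : ℝ → ℝ, ContinuousOn β (Icc 0 T) → (∀ θ ∈ Icc 0 T, |β θ - hi| ≤ L * T) →
      0 < s * ∫ θ in (0 : ℝ)..T, f θ (β θ)) :
    ∃ ρ : ℝ → ℝ, (∀ θ, HasDerivAt ρ (f θ (ρ θ)) θ) ∧ Function.Periodic ρ T ∧
      ∃ x ∈ Icc lo hi, ∀ θ, |ρ θ - x| ≤ L * T := by
  have h0T : (0 : ℝ) ∈ Icc 0 T := ⟨le_rfl, hT.le⟩
  have hTT : T ∈ Icc 0 T := ⟨hT.le, le_rfl⟩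
  set r : ℝ≥0 := ⟨hi - lo, sub_nonneg.2 hlohi⟩ with hr
  have hPL : IsPicardLindelof f (⟨0, h0T⟩ : Icc (0 : ℝ) T) lo (r + L * ⟨T, hT.le⟩) r L K :=
    { lipschitzOnWith := fun t _ => (hlip t).lipschitzOnWith
      continuousOn := fun x _ => by
        have : Continuous fun t => f t x := hf.comp (by fun_prop : Continuous fun t : ℝ => (t, x))
        exact this.continuousOn
      norm_le := fun t _ x _ => hL t x
      mul_max_le := by
        have : ((L * ⟨T, hT.le⟩ : ℝ≥0) : ℝ) = L * T := rfl
        simp [hT.le, this] }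
  obtain ⟨α, hα, K', hK'⟩ := hPL.exists_forall_mem_closedBall_eq_hasDerivWithinAt_lipschitzOnWith
  have hmem : ∀ x ∈ Icc lo hi, x ∈ Metric.closedBall lo (r : ℝ) := by
    intro x hx
    rw [Metric.mem_closedBall, Real.dist_eq, abs_of_nonneg (sub_nonneg.2 hx.1)]
    exact sub_le_sub_right hx.2 lo
  have hc : ∀ x ∈ Icc lo hi, ContinuousOn (α x) (Icc 0 T) := fun x hx θ hθ =>
    ((hα x (hmem x hx)).2 θ hθ).continuousWithinAt
  have hbd : ∀ x ∈ Icc lo hi, ∀ θ ∈ Icc 0 T, |α x θ - x| ≤ L * T := by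
    intro x hx θ hθ
    have h1 := (convex_Icc 0 T).norm_image_sub_le_of_norm_hasDerivWithin_le (C := (L : ℝ))
      (hα x (hmem x hx)).2 (fun t _ => hL t _) h0T hθ
    have h2 := (hα x (hmem x hx)).1
    simp only at h2
    rw [h2, sub_zero, Real.norm_eq_abs, Real.norm_eq_abs, abs_of_nonneg hθ.1] at h1
    exact h1.trans (mul_le_mul_of_nonneg_left hθ.2 L.2)
  have hcf : ∀ x ∈ Icc lo hi, ContinuousOn (fun θ => f θ (α x θ)) (Icc 0 T) := fun x hx =>
    hf.comp_continuousOn (continuousOn_id.prodMk (hc x hx))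
  have hint : ∀ x ∈ Icc lo hi, ∀ θ ∈ Icc 0 T, ∫ t in (0 : ℝ)..θ, f t (α x t) = α x θ - x := by
    intro x hx θ hθ
    have h2 := (hα x (hmem x hx)).1
    simp only at h2
    have hsub : Icc 0 θ ⊆ Icc 0 T := Icc_subset_Icc_right hθ.2
    suffices h : ∫ t in (0 : ℝ)..θ, f t (α x t) = α x θ - α x 0 by rw [h, h2]
    refine intervalIntegral.integral_eq_sub_of_hasDeriv_right_of_le hθ.1
      ((hc x hx).mono hsub) (fun t ht => ?_) ?_
    · have ht' : t ∈ Ico 0 T := ⟨ht.1.le, ht.2.trans_le hθ.2⟩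
      exact ((hα x (hmem x hx)).2 t ⟨ht'.1, ht'.2.le⟩).mono_of_mem_nhdsWithin
        (mem_of_superset (Ioc_mem_nhdsGT ht'.2)
          (Ioc_subset_Icc_self.trans (Icc_subset_Icc_left ht'.1)))
    · refine ContinuousOn.intervalIntegrable ?_
      rw [uIcc_of_le hθ.1]
      exact (hcf x hx).mono hsub
  obtain ⟨x, hx, hx0⟩ : ∃ x ∈ Icc lo hi, s * (α x T - x) = 0 := by
    have h1 : ContinuousOn (fun x => s * (α x T - x)) (Icc lo hi) :=
      continuousOn_const.mul ((((hK' T hTT).continuousOn).mono hmem).sub continuousOn_id)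
    refine intermediate_value_Icc hlohi h1 ⟨?_, ?_⟩
    · have hx : lo ∈ Icc lo hi := ⟨le_rfl, hlohi⟩
      have := hlo _ (hc lo hx) (hbd lo hx)
      rw [hint lo hx T hTT] at this
      exact this.le
    · have hx : hi ∈ Icc lo hi := ⟨hlohi, le_rfl⟩
      have := hhi _ (hc hi hx) (hbd hi hx)
      rw [hint hi hx T hTT] at this
      exact this.le
  have hs : s ≠ 0 := by
    rintro rfl
    have hx : lo ∈ Icc lo hi := ⟨le_rfl, hlohi⟩
    simpa using hlo _ (hc lo hx) (hbd lo hx)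
  have hfix : α x T = x := by
    have := (mul_eq_zero.1 hx0).resolve_left hs
    linarith
  have hstart : α x 0 = x := (hα x (hmem x hx)).1
  have : Fact (0 < T) := ⟨hT⟩
  set R : ℝ → ℝ := fun θ => AddCircle.liftIco T 0 (α x) (θ : AddCircle T) with hR
  have hRc : Continuous R := by
    refine (AddCircle.liftIco_zero_continuous (by rw [hstart, hfix]) (hc x hx)).comp ?_
    exact AddCircle.continuous_mk' T
  have hRp : Function.Periodic R T := fun θ => by simp [hR]
  have hR' : ∀ θ ∈ Icc 0 T, R θ = α x θ := by
    intro θ hθ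
    rcases hθ.2.lt_or_eq with h | h
    · exact AddCircle.liftIco_zero_coe_apply ⟨hθ.1, h⟩
    · have h1 := hRp 0
      have h2 : R 0 = α x 0 := AddCircle.liftIco_zero_coe_apply ⟨le_rfl, hT⟩
      rw [zero_add, h2, hstart] at h1
      rw [h, h1, hfix]
  have hg : Continuous fun θ => f θ (R θ) := hf.comp (continuous_id.prodMk hRc)
  have hgp : Function.Periodic (fun θ => f θ (R θ)) T := fun θ => by
    simp only [hper, hRp θ]
  have hgint : ∀ θ ∈ Icc 0 T, ∫ t in (0 : ℝ)..θ, f t (R t) = R θ - x := by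
    intro θ hθ
    rw [hR' θ hθ, ← hint x hx θ hθ]
    refine intervalIntegral.integral_congr fun t ht => ?_
    rw [uIcc_of_le hθ.1] at ht
    simp only [hR' t ⟨ht.1, ht.2.trans hθ.2⟩]
  have hG : ∀ θ, x + ∫ t in (0 : ℝ)..θ, f t (R t) = R θ := by
    have hP : Function.Periodic (fun θ => x + (∫ t in (0 : ℝ)..θ, f t (R t)) - R θ) T := by
      intro θ
      have hi' : ∀ t₁ t₂, IntervalIntegrable (fun θ => f θ (R θ)) volume t₁ t₂ :=
        fun _ _ => hg.intervalIntegrable _ _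
      have h1 := intervalIntegral.integral_add_adjacent_intervals (hi' 0 θ) (hi' θ (θ + T))
      have h2 := hgp.intervalIntegral_add_eq θ 0
      rw [zero_add, hgint T hTT, hR' T hTT, hfix, sub_self] at h2
      simp only [← h1, h2, hRp θ, add_zero]
    intro θ
    obtain ⟨y, hy, hye⟩ := hP.exists_mem_Ico₀ hT θ
    have := hgint y ⟨hy.1, hy.2.le⟩
    rw [this] at hye
    linarith
  refine ⟨R, fun θ => ?_, hRp, x, hx, fun θ => ?_⟩
  · have h1 := (hg.integral_hasStrictDerivAt 0 θ).hasDerivAt.const_add x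
    exact h1.congr_of_eventuallyEq (Eventually.of_forall fun y => (hG y).symm)
  · obtain ⟨y, hy, hye⟩ := hRp.exists_mem_Ico₀ hT θ
    have hy' : y ∈ Icc 0 T := ⟨hy.1, hy.2.le⟩
    rw [hye, hR' y hy']
    exact hbd x hx y hy'

theorem exists_int_shift {F : (ℝ × ℝ) × ℝ → ℝ} {T : ℝ} (hT : 0 < T)
    (hper : ∀ p θ, F (p, θ + T) = F (p, θ)) (θ : ℝ) :
    ∃ c : ℝ, θ + c ∈ Icc 0 T ∧ F = fun q => F (q + (0, c)) := by
  refine ⟨-toIcoDiv hT 0 θ • T, ?_, ?_⟩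
  · have h := sub_toIcoDiv_zsmul_mem_Ico hT 0 θ
    rw [zero_add] at h
    rw [neg_smul, ← sub_eq_add_neg]
    exact Ico_subset_Icc_self h
  · funext ⟨p, x⟩
    have h : Function.Periodic (fun x => F (p, x)) T := fun x => hper p x
    have h2 := (h.zsmul (-toIcoDiv hT 0 θ)) x
    simp only [neg_smul] at h2
    simpa using h2.symm

theorem radialDeriv_shift {F : (ℝ × ℝ) × ℝ → ℝ} {c : ℝ} (h : F = fun q => F (q + (0, c)))
    (q : (ℝ × ℝ) × ℝ) : radialDeriv F q = radialDeriv F (q + (0, c)) := by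
  unfold radialDeriv
  conv_lhs => rw [h]
  rw [fderiv_comp_add_right]

theorem contDiffAt_shift {F : (ℝ × ℝ) × ℝ → ℝ} {c : ℝ} (h : F = fun q => F (q + (0, c)))
    {q : (ℝ × ℝ) × ℝ} (hq : ContDiffAt ℝ 1 F (q + (0, c))) : ContDiffAt ℝ 1 F q := by
  rw [h]
  exact hq.comp (g := F) (f := fun q => q + (0, c)) q (by fun_prop)

/-- Uniform estimates near `(0, r₀)` for a function that is periodic in the angle. -/
theorem exists_uniform_box {F : (ℝ × ℝ) × ℝ → ℝ} {r₀ T κ : ℝ} (hT : 0 < T)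
    (hF : ∀ θ, ContDiffAt ℝ 1 F ((0, r₀), θ)) (hper : ∀ p θ, F (p, θ + T) = F (p, θ))
    (hκ : 0 < κ) :
    ∃ τ > 0, ∃ C > 0, (∀ θ, |radialDeriv F ((0, r₀), θ)| ≤ C) ∧
      ∀ p : ℝ × ℝ, |p.1| < τ → |p.2 - r₀| < τ → ∀ θ,
      ContDiffAt ℝ 1 F (p, θ) ∧ |radialDeriv F (p, θ) - radialDeriv F ((0, r₀), θ)| < κ ∧
      |F (p, θ)| ≤ C := by
  have hc1 : ∀ θ ∈ Icc 0 T, ContinuousAt F ((0, r₀), θ) := fun θ _ => (hF θ).continuousAt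
  have hc2 : ∀ θ ∈ Icc 0 T, ContinuousAt (radialDeriv F) ((0, r₀), θ) := fun θ _ =>
    continuousAt_radialDeriv (hF θ)
  obtain ⟨C1, hC1⟩ := isCompact_Icc.exists_bound_of_continuousOn (continuousOn_slice hc1)
  obtain ⟨C2, hC2⟩ := isCompact_Icc.exists_bound_of_continuousOn (continuousOn_slice hc2)
  have hev := (eventually_forall_contDiffAt (a := 0) (b := T) fun θ _ => hF θ).and
    ((eventually_forall_abs_sub_lt hc2 hκ).and (eventually_forall_abs_sub_lt hc1 one_pos))
  obtain ⟨τ, hτ, hbox⟩ := Metric.eventually_nhds_iff.1 hev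
  refine ⟨τ, hτ, |C1| + |C2| + 1, by positivity, fun θ => ?_, fun p hp1 hp2 θ => ?_⟩
  · obtain ⟨c, hc, hs⟩ := exists_int_shift hT hper θ
    rw [radialDeriv_shift hs]
    have := hC2 _ hc
    simp only [Real.norm_eq_abs] at this
    simp only [Prod.mk_add_mk, add_zero]
    linarith [le_abs_self C2, abs_nonneg C1]
  · obtain ⟨c, hc, hs⟩ := exists_int_shift hT hper θ
    have hd : dist p (0, r₀) < τ := by
      rw [Prod.dist_eq]
      exact max_lt (by simpa [Real.dist_eq] using hp1) (by simpa [Real.dist_eq] using hp2)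
    obtain ⟨h1, h2, h3⟩ := hbox hd
    refine ⟨contDiffAt_shift hs (by simpa using h1 _ hc), ?_, ?_⟩
    · rw [radialDeriv_shift hs, radialDeriv_shift hs ((0, r₀), θ)]
      simpa using h2 _ hc
    · have h4 := h3 _ hc
      have h5 := hC1 _ hc
      rw [show F (p, θ) = F (p, θ + c) by conv_lhs => rw [hs]
                                          simp]
      rw [Real.norm_eq_abs] at h5
      have := abs_add_le (F (p, θ + c) - F ((0, r₀), θ + c)) (F ((0, r₀), θ + c))
      rw [sub_add_cancel] at this
      linarith [le_abs_self C1, abs_nonneg C2]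

theorem abs_sub_sub_mul_le {F : (ℝ × ℝ) × ℝ → ℝ} {ε θ a κ lo hi x y : ℝ}
    (h : ∀ r ∈ Icc lo hi, ContDiffAt ℝ 1 F ((ε, r), θ) ∧ |radialDeriv F ((ε, r), θ) - a| ≤ κ)
    (hx : x ∈ Icc lo hi) (hy : y ∈ Icc lo hi) :
    |F ((ε, x), θ) - F ((ε, y), θ) - a * (x - y)| ≤ κ * |x - y| := by
  have := (convex_Icc lo hi).norm_image_sub_le_of_norm_hasDerivWithin_le (𝕜 := ℝ)
    (f := fun r => F ((ε, r), θ) - a * r) (f' := fun r => radialDeriv F ((ε, r), θ) - a) (C := κ)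
    (fun r hr => by
      exact ((hasDerivAt_radial (h r hr).1).fun_sub ((hasDerivAt_id r).const_mul a)).congr_deriv
        (by simp) |>.hasDerivWithinAt) (fun r hr => by simpa using (h r hr).2) hy hx
  simp only [Real.norm_eq_abs] at this
  rw [show F ((ε, x), θ) - F ((ε, y), θ) - a * (x - y) =
    F ((ε, x), θ) - a * x - (F ((ε, y), θ) - a * y) by ring]
  exact this

theorem periodic_solution_unique {F : (ℝ × ℝ) × ℝ → ℝ} {r₀ T κ τ d ε : ℝ} (hT : 0 < T)
    (hF : ∀ θ, ContDiffAt ℝ 1 F ((0, r₀), θ)) (hper : ∀ p θ, F (p, θ + T) = F (p, θ))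
    (hd : ∫ θ in (0 : ℝ)..T, radialDeriv F ((0, r₀), θ) = d) (hκ : κ * T < |d|)
    (hbox : ∀ p : ℝ × ℝ, |p.1| < τ → |p.2 - r₀| < τ → ∀ θ,
      ContDiffAt ℝ 1 F (p, θ) ∧ |radialDeriv F (p, θ) - radialDeriv F ((0, r₀), θ)| < κ)
    (hε : 0 < ε) (hετ : ε < τ) {ρ ρ' : ℝ → ℝ} (hρ : ∀ θ, HasDerivAt ρ (ε * F ((ε, ρ θ), θ)) θ)
    (hρ' : ∀ θ, HasDerivAt ρ' (ε * F ((ε, ρ' θ), θ)) θ)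
    {η : ℝ} (hη : η < τ) (hr : ∀ θ, |ρ θ - r₀| ≤ η) (hr' : ∀ θ, |ρ' θ - r₀| ≤ η)
    {k : ℕ} (hk : 1 ≤ k) (hp : Function.Periodic ρ T) (hp' : Function.Periodic ρ' (k * T)) :
    ρ' = ρ := by
  set a : ℝ → ℝ := fun θ => radialDeriv F ((0, r₀), θ) with ha
  have hac : Continuous a := continuous_iff_continuousAt.2 fun θ =>
    ContinuousAt.comp (f := fun θ : ℝ => (((0, r₀), θ) : (ℝ × ℝ) × ℝ))
      (continuousAt_radialDeriv (hF θ)) (by fun_prop)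
  have haT : Function.Periodic a T := fun θ => by
    have h : F = fun q => F (q + (0, T)) := by
      funext ⟨p, x⟩
      simpa using (hper p x).symm
    have := radialDeriv_shift h ((0, r₀), θ)
    simpa [ha] using this.symm
  set w : ℝ → ℝ := fun θ => ρ' θ - ρ θ with hw
  set w' : ℝ → ℝ := fun θ => ε * F ((ε, ρ' θ), θ) - ε * F ((ε, ρ θ), θ) with hw'
  have hwd : ∀ θ, HasDerivAt w (w' θ) θ := fun θ => (hρ' θ).fun_sub (hρ θ)
  have hwp : Function.Periodic w (k * T) := fun θ => by
    have h1 := hp' θ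
    have h2 := hp.nat_mul k θ
    simp only [hw, h1, h2]
  have hkey : ∀ θ, |w' θ - ε * (a θ * w θ)| ≤ ε * (κ * |w θ|) := fun θ => by
    have := abs_sub_sub_mul_le (F := F) (ε := ε) (θ := θ) (a := a θ) (κ := κ) (lo := r₀ - η)
      (hi := r₀ + η) (x := ρ' θ) (y := ρ θ) (fun r hr => by
        have := hbox (ε, r) (by rwa [abs_of_pos hε]) (by
          rw [abs_lt]; constructor <;> linarith [hr.1, hr.2]) θ
        exact ⟨this.1, this.2.le⟩)
      (by have := abs_le.1 (hr' θ); constructor <;> linarith)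
      (by have := abs_le.1 (hr θ); constructor <;> linarith)
    have h2 : w' θ - ε * (a θ * w θ) =
        ε * (F ((ε, ρ' θ), θ) - F ((ε, ρ θ), θ) - a θ * (ρ' θ - ρ θ)) := by
      simp only [hw, hw']; ring
    rw [h2, abs_mul, abs_of_pos hε]
    exact mul_le_mul_of_nonneg_left this hε.le
  have hkey2 : ∀ θ, |w θ * w' θ - ε * a θ * w θ ^ 2| ≤ ε * κ * w θ ^ 2 := fun θ => by
    have := mul_le_mul_of_nonneg_left (hkey θ) (abs_nonneg (w θ))
    rw [← abs_mul] at this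
    rw [← sq_abs (w θ)]
    rw [sq_abs]
    calc _ = |w θ * (w' θ - ε * (a θ * w θ))| := by congr 1; ring
      _ ≤ _ := this
      _ = ε * κ * |w θ| ^ 2 := by ring
      _ = _ := by rw [sq_abs]
  suffices h : ∀ θ, w θ = 0 from funext fun θ => sub_eq_zero.1 (h θ)
  rcases le_or_gt 0 d with hd0 | hd0
  · rw [abs_of_nonneg hd0] at hκ
    refine eq_zero_of_periodic_of_growth hk hT.le hwd (b := fun θ => ε * (a θ - κ))
      (by fun_prop) (fun θ => by simp only [haT θ]) ?_ (fun θ => ?_) hwp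
    · rw [intervalIntegral.integral_const_mul, intervalIntegral.integral_sub
        (hac.intervalIntegrable _ _) (by simp), hd]
      simp only [intervalIntegral.integral_const, smul_eq_mul]
      exact mul_pos hε (by linarith)
    · have := (abs_le.1 (hkey2 θ)).1
      linarith
  · rw [abs_of_neg hd0] at hκ
    have h := eq_zero_of_periodic_of_growth (w := fun θ => w (-θ)) (w' := fun θ => -w' (-θ))
      hk hT.le (fun θ => ((hwd (-θ)).scomp θ (hasDerivAt_neg θ)).congr_deriv (by simp))
      (b := fun θ => ε * (-a (-θ) - κ))
      (by fun_prop) (fun θ => by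
        have := haT (-θ - T)
        rw [sub_add_cancel] at this
        simp only [neg_add', ← this]) ?_ (fun θ => ?_) (fun θ => by
        have := hwp (-θ - k * T)
        rw [sub_add_cancel] at this
        simp only [neg_add', ← this])
    · exact fun θ => by simpa using h (-θ)
    · rw [intervalIntegral.integral_const_mul, intervalIntegral.integral_sub
        ((by fun_prop : Continuous fun θ => -a (-θ)).intervalIntegrable _ _) (by simp),
        intervalIntegral.integral_neg, intervalIntegral.integral_comp_neg]
      have h3 := haT.intervalIntegral_add_eq (-T) 0
      rw [neg_add_cancel, zero_add, hd] at h3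
      rw [neg_zero, h3]
      simp only [intervalIntegral.integral_const, smul_eq_mul]
      exact mul_pos hε (by linarith)
    · have := (abs_le.1 (hkey2 (-θ))).2
      linarith

theorem periodic_solution_exists {F : (ℝ × ℝ) × ℝ → ℝ} {r₀ T τ κ C η s : ℝ} (hT : 0 < T)
    (hper : ∀ p θ, F (p, θ + T) = F (p, θ)) {a : ℝ → ℝ} (ha : ∀ θ, |a θ| ≤ C) (hC : 0 < C)
    (hbox : ∀ p : ℝ × ℝ, |p.1| < τ → |p.2 - r₀| < τ → ∀ θ,
      ContDiffAt ℝ 1 F (p, θ) ∧ |radialDeriv F (p, θ) - a θ| < κ ∧ |F (p, θ)| ≤ C)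
    (hη : 0 < η) (hητ : 2 * η < τ)
    (hlo : s * (∫ θ in (0 : ℝ)..T, F ((0, r₀ - η), θ)) < 0)
    (hhi : 0 < s * (∫ θ in (0 : ℝ)..T, F ((0, r₀ + η), θ))) :
    ∀ᶠ ε in 𝓝[>] (0 : ℝ), ∃ ρ : ℝ → ℝ, (∀ θ, |ρ θ - r₀| < 2 * η) ∧
      (∀ θ, HasDerivAt ρ (ε * F ((ε, ρ θ), θ)) θ) ∧ Function.Periodic ρ T := by
  have hτ : 0 < τ := by linarith
  have hcont : ∀ p : ℝ × ℝ, |p.1| < τ → |p.2 - r₀| < τ → ∀ θ, ContinuousAt F (p, θ) :=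
    fun p h1 h2 θ => (hbox p h1 h2 θ).1.continuousAt
  -- the averaged integral keeps its sign under small perturbations
  have hsign : ∀ (x₀ σ : ℝ), |x₀ - r₀| < τ → 0 < σ * (∫ θ in (0 : ℝ)..T, F ((0, x₀), θ)) →
      ∃ τ' > 0, ∀ ε, |ε| < τ' → ∀ β : ℝ → ℝ, ContinuousOn β (Icc 0 T) →
        (∀ θ ∈ Icc 0 T, |β θ - x₀| < τ') → (∀ θ ∈ Icc 0 T, |β θ - r₀| < τ) → |ε| < τ →
        0 < σ * ∫ θ in (0 : ℝ)..T, F ((ε, β θ), θ) := by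
    intro x₀ σ hx hpos
    set I := ∫ θ in (0 : ℝ)..T, F ((0, x₀), θ) with hI
    have hσ : 0 < |σ| := abs_pos.2 fun h => by simp [h] at hpos
    set κ' := σ * I / (2 * T * |σ|) with hκ'
    have hκ0 : 0 < κ' := by positivity
    obtain ⟨τ', hτ', hb⟩ := Metric.eventually_nhds_iff.1 (eventually_forall_abs_sub_lt
      (a := 0) (b := T) (fun θ _ => hcont (0, x₀) (by simpa using hτ) hx θ) hκ0)
    refine ⟨τ', hτ', fun ε hε β hβ h1 h2 h3 => ?_⟩
    have hi1 : IntervalIntegrable (fun θ => F ((ε, β θ), θ)) volume 0 T := by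
      refine ContinuousOn.intervalIntegrable ?_
      rw [uIcc_of_le hT.le]
      exact fun θ hθ => (hcont (ε, β θ) h3 (h2 θ hθ) θ).comp_continuousWithinAt
        (f := fun θ => (((ε, β θ), θ) : (ℝ × ℝ) × ℝ))
        ((continuousWithinAt_const.prodMk (hβ θ hθ)).prodMk continuousWithinAt_id)
    have hi2 : IntervalIntegrable (fun θ => F ((0, x₀), θ)) volume 0 T := by
      refine ContinuousOn.intervalIntegrable ?_
      exact continuousOn_slice fun θ _ => hcont (0, x₀) (by simpa using hτ) hx θ
    have hdiff : |(∫ θ in (0 : ℝ)..T, F ((ε, β θ), θ)) - I| ≤ κ' * T := by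
      rw [hI, ← intervalIntegral.integral_sub hi1 hi2]
      have := intervalIntegral.norm_integral_le_of_norm_le_const (a := 0) (b := T) (C := κ')
        (f := fun θ => F ((ε, β θ), θ) - F ((0, x₀), θ)) (fun θ hθ => by
          rw [uIoc_of_le hT.le] at hθ
          have hθ' := Ioc_subset_Icc_self hθ
          exact (hb (y := (ε, β θ)) (by
            rw [Prod.dist_eq]
            exact max_lt (by simpa [Real.dist_eq] using hε)
              (by simpa [Real.dist_eq] using h1 θ hθ')) θ hθ').le)
      simpa [abs_of_pos hT] using this
    have h4 : |σ * (∫ θ in (0 : ℝ)..T, F ((ε, β θ), θ)) - σ * I| ≤ |σ| * (κ' * T) := by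
      rw [← mul_sub, abs_mul]
      exact mul_le_mul_of_nonneg_left hdiff hσ.le
    have h5 : |σ| * (κ' * T) = σ * I / 2 := by rw [hκ']; field_simp
    have := (abs_le.1 h4).1
    linarith
  obtain ⟨τ₁, hτ₁, h₁⟩ := hsign (r₀ - η) (-s) (by rw [abs_lt]; constructor <;> linarith)
    (by linarith)
  obtain ⟨τ₂, hτ₂, h₂⟩ := hsign (r₀ + η) s (by rw [abs_lt]; constructor <;> linarith) hhi
  set m := min (min τ₁ τ₂) η with hm
  have hm0 : 0 < m := by positivity
  have hm1 : m ≤ τ₁ := (min_le_left _ _).trans (min_le_left _ _)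
  have hm2 : m ≤ τ₂ := (min_le_left _ _).trans (min_le_right _ _)
  have hm3 : m ≤ η := min_le_right _ _
  have hsmall : ∀ᶠ ε in 𝓝[>] (0 : ℝ), ε < min m (m / (2 * (C * T))) :=
    mem_nhdsWithin_of_mem_nhds (Iio_mem_nhds (by positivity))
  filter_upwards [hsmall, self_mem_nhdsWithin] with ε hεs hε0
  have hε0 : 0 < ε := hε0
  have hεm : ε < m := hεs.trans_le (min_le_left _ _)
  have hεL : ε * C * T < m := by
    have := hεs.trans_le (min_le_right _ _)
    rw [lt_div_iff₀ (by positivity)] at this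
    nlinarith [mul_pos hε0 (mul_pos hC hT)]
  have hετ : |ε| < τ := by rw [abs_of_pos hε0]; linarith
  set cl : ℝ → ℝ := fun x => max (r₀ - 2 * η) (min x (r₀ + 2 * η)) with hcl
  have hcl1 : ∀ x, |cl x - r₀| ≤ 2 * η := fun x => by
    rw [abs_le]
    have h1 : r₀ - 2 * η ≤ cl x := le_max_left _ _
    have h2 : cl x ≤ r₀ + 2 * η := max_le (by linarith) (min_le_right _ _)
    constructor <;> linarith
  have hclτ : ∀ x, |cl x - r₀| < τ := fun x => (hcl1 x).trans_lt hητ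
  have hcl2 : ∀ x, |x - r₀| ≤ 2 * η → cl x = x := fun x hx => by
    rw [abs_le] at hx
    simp only [hcl]
    rw [min_eq_left (by linarith), max_eq_right (by linarith)]
  have hclc : Continuous cl := by fun_prop
  have hcll : ∀ x y, |cl x - cl y| ≤ |x - y| := fun x y =>
    by
      simp only [hcl]
      rw [max_comm, max_comm (r₀ - 2 * η)]
      exact (abs_max_sub_max_le_abs _ _ _).trans (by simpa using abs_min_sub_min_le_max x (r₀ + 2 * η) y (r₀ + 2 * η))
  have hint : ∀ β : ℝ → ℝ, (∀ θ ∈ Icc 0 T, |β θ - r₀| ≤ 2 * η) →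
      ∫ θ in (0 : ℝ)..T, ε * F ((ε, cl (β θ)), θ) = ε * ∫ θ in (0 : ℝ)..T, F ((ε, β θ), θ) :=
    fun β hβ => by
      rw [intervalIntegral.integral_const_mul]
      congr 1
      refine intervalIntegral.integral_congr fun θ hθ => ?_
      rw [uIcc_of_le hT.le] at hθ
      simp only [hcl2 _ (hβ θ hθ)]
  have hκ0 : 0 ≤ κ := (abs_nonneg _).trans (hbox (ε, r₀) hετ (by simpa using hτ) 0).2.1.le
  obtain ⟨K, hK⟩ : ∃ K : ℝ≥0, (K : ℝ) = ε * (C + κ) := ⟨_, Real.coe_toNNReal _ (by positivity)⟩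
  obtain ⟨L, hL⟩ : ∃ L : ℝ≥0, (L : ℝ) = ε * C := ⟨_, Real.coe_toNNReal _ (by positivity)⟩
  obtain ⟨ρ, h1, h2, x, hx, h3⟩ := exists_periodic_solution
    (f := fun θ x => ε * F ((ε, cl x), θ)) (K := K) (L := L)
    (T := T) (lo := r₀ - η) (hi := r₀ + η) (s := s) hT (by linarith)
    (continuous_iff_continuousAt.2 fun q => by
      refine continuousAt_const.mul (ContinuousAt.comp
        (f := fun q : ℝ × ℝ => (((ε, cl q.2), q.1) : (ℝ × ℝ) × ℝ))
        (hcont (ε, cl q.2) hετ (hclτ _) _) (by fun_prop)))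
    (fun θ => LipschitzWith.of_dist_le_mul fun x y => by
      have h := abs_sub_sub_mul_le (F := F) (ε := ε) (θ := θ) (a := a θ) (κ := κ)
        (lo := r₀ - 2 * η) (hi := r₀ + 2 * η) (x := cl x) (y := cl y) (fun r hr => by
          have := hbox (ε, r) hετ (by rw [abs_lt]; constructor <;> linarith [hr.1, hr.2]) θ
          exact ⟨this.1, this.2.1.le⟩)
        (by have := abs_le.1 (hcl1 x); constructor <;> linarith)
        (by have := abs_le.1 (hcl1 y); constructor <;> linarith)
      simp only [Real.dist_eq]
      rw [hK]
      rw [← mul_sub, abs_mul, abs_of_pos hε0, mul_assoc]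
      refine mul_le_mul_of_nonneg_left ?_ hε0.le
      have h5 := abs_add_le (F ((ε, cl x), θ) - F ((ε, cl y), θ) - a θ * (cl x - cl y))
        (a θ * (cl x - cl y))
      rw [sub_add_cancel, abs_mul] at h5
      calc _ ≤ _ := h5
        _ ≤ κ * |cl x - cl y| + C * |cl x - cl y| :=
          add_le_add h (mul_le_mul_of_nonneg_right (ha θ) (abs_nonneg _))
        _ = (C + κ) * |cl x - cl y| := by ring
        _ ≤ (C + κ) * |x - y| := mul_le_mul_of_nonneg_left (hcll x y) (by positivity))
    (fun θ x => by
      rw [abs_mul, abs_of_pos hε0, hL]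
      exact mul_le_mul_of_nonneg_left (hbox (ε, cl x) hετ (hclτ x) θ).2.2 hε0.le)
    (fun θ x => by simp only [hper])
    (fun β hβ hβ2 => by
      simp only [hL] at hβ2
      have hβ3 : ∀ θ ∈ Icc 0 T, |β θ - r₀| ≤ 2 * η := fun θ hθ => by
        have := abs_le.1 (hβ2 θ hθ)
        rw [abs_le]; constructor <;> linarith
      rw [hint β hβ3]
      have := h₁ ε (by rw [abs_of_pos hε0]; linarith) β hβ
        (fun θ hθ => by linarith [hβ2 θ hθ]) (fun θ hθ => (hβ3 θ hθ).trans_lt hητ) hετ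
      nlinarith)
    (fun β hβ hβ2 => by
      simp only [hL] at hβ2
      have hβ3 : ∀ θ ∈ Icc 0 T, |β θ - r₀| ≤ 2 * η := fun θ hθ => by
        have := abs_le.1 (hβ2 θ hθ)
        rw [abs_le]; constructor <;> linarith
      rw [hint β hβ3]
      have := h₂ ε (by rw [abs_of_pos hε0]; linarith) β hβ
        (fun θ hθ => by linarith [hβ2 θ hθ]) (fun θ hθ => (hβ3 θ hθ).trans_lt hητ) hετ
      nlinarith)
  simp only [hL] at h3
  have hr : ∀ θ, |ρ θ - r₀| < 2 * η := fun θ => by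
    have := abs_le.1 (h3 θ)
    rw [abs_lt]; constructor <;> linarith [hx.1, hx.2]
  refine ⟨ρ, hr, fun θ => ?_, h2⟩
  have := h1 θ
  rwa [hcl2 _ (hr θ).le] at this

/-- First order averaging: a simple zero of the averaged function yields, for small `ε > 0`, a
periodic solution which is unique in a neighbourhood independent of `ε`. -/
theorem averaging {F : (ℝ × ℝ) × ℝ → ℝ} {r₀ T d ζ : ℝ} (hT : 0 < T)
    (hF : ∀ θ, ContDiffAt ℝ 1 F ((0, r₀), θ)) (hper : ∀ p θ, F (p, θ + T) = F (p, θ))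
    (h0 : ∫ θ in (0 : ℝ)..T, F ((0, r₀), θ) = 0)
    (hd : HasDerivAt (fun x => ∫ θ in (0 : ℝ)..T, F ((0, x), θ)) d r₀) (hd0 : d ≠ 0)
    (hζ : 0 < ζ) :
    ∃ η > 0, η < ζ ∧ ∀ᶠ ε in 𝓝[>] (0 : ℝ), ∃ ρ : ℝ → ℝ, (∀ θ, |ρ θ - r₀| < η) ∧
      (∀ θ, HasDerivAt ρ (ε * F ((ε, ρ θ), θ)) θ) ∧ Function.Periodic ρ T ∧
      ∀ (ρ' : ℝ → ℝ) (k : ℕ), 1 ≤ k → (∀ θ, |ρ' θ - r₀| < η) →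
        (∀ θ, HasDerivAt ρ' (ε * F ((ε, ρ' θ), θ)) θ) → Function.Periodic ρ' (k * T) →
        ρ' = ρ := by
  have hκ : 0 < |d| / (2 * T) := by positivity
  obtain ⟨τ, hτ, C, hC, ha, hbox⟩ := exists_uniform_box hT hF hper hκ
  have hdi := (hasDerivAt_integral_slice hT.le fun θ _ => hF θ).unique hd
  have hs : ∃ s : ℝ, 0 < s * d := ⟨d, mul_self_pos.2 hd0⟩
  obtain ⟨s, hs⟩ := hs
  have hev := eventually_sign_of_hasDerivAt
    (M := fun x => s * ∫ θ in (0 : ℝ)..T, F ((0, x), θ)) (by simp [h0]) (hd.const_mul s) hs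
  have hev2 : ∀ᶠ η in 𝓝[>] (0 : ℝ), η < min τ ζ / 2 :=
    mem_nhdsWithin_of_mem_nhds (Iio_mem_nhds (by positivity))
  obtain ⟨η, ⟨⟨h1, h2⟩, h3⟩, h4⟩ := ((hev.and hev2).and self_mem_nhdsWithin).exists
  have h4 : 0 < η := h4
  have h5 : 2 * η < τ := by linarith [min_le_left τ ζ]
  have h6 : 2 * η < ζ := by linarith [min_le_right τ ζ]
  refine ⟨2 * η, by positivity, h6, ?_⟩
  have hετ : ∀ᶠ ε in 𝓝[>] (0 : ℝ), ε < τ := mem_nhdsWithin_of_mem_nhds (Iio_mem_nhds hτ)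
  filter_upwards [periodic_solution_exists hT hper ha hC hbox h4 h5 h1 h2, hετ,
    self_mem_nhdsWithin] with ε ⟨ρ, e1, e2, e3⟩ hετ hε
  refine ⟨ρ, e1, e2, e3, fun ρ' k hk f1 f2 f3 => ?_⟩
  exact periodic_solution_unique hT hF hper hdi (by
      rw [div_mul_eq_mul_div, div_lt_iff₀ (by positivity)]
      nlinarith [abs_pos.2 hd0])
    (fun p h1 h2 θ => ⟨(hbox p h1 h2 θ).1, (hbox p h1 h2 θ).2.1⟩) hε hετ e2 f2 h5
    (fun θ => (e1 θ).le) (fun θ => (f1 θ).le) hk e3 f3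

theorem exists_inverse_of_deriv_ge {u v : ℝ → ℝ} {m : ℝ} (hu : ∀ t, HasDerivAt u (v t) t)
    (hm : 0 < m) (hv : ∀ t, m ≤ v t) :
    ∃ w : ℝ → ℝ, (∀ s, u (w s) = s) ∧ (∀ t, w (u t) = t) ∧
      ∀ s, HasDerivAt w (v (w s))⁻¹ s := by
  have hcont : Continuous u := continuous_iff_continuousAt.2 fun t => (hu t).continuousAt
  have hmono : StrictMono u := strictMono_of_deriv_pos fun t => by
    rw [(hu t).deriv]; exact hm.trans_le (hv t)
  have hmono2 : Monotone fun t => u t - m * t := monotone_of_deriv_nonneg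
    (fun t => ((hu t).sub ((hasDerivAt_id t).const_mul m)).differentiableAt) fun t => by
      have := ((hu t).fun_sub ((hasDerivAt_id t).const_mul m)).deriv
      simp only [id_eq, mul_one] at this
      rw [this]; linarith [hv t]
  have htop : Tendsto u atTop atTop := by
    refine tendsto_atTop_mono' _ ?_
      (tendsto_atTop_add_const_left _ (u 0) (tendsto_id.const_mul_atTop hm))
    filter_upwards [eventually_ge_atTop 0] with t ht
    have := hmono2 ht
    simp only [id_eq] at *
    linarith
  have hbot : Tendsto u atBot atBot := by
    refine tendsto_atBot_mono' _ ?_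
      (tendsto_atBot_add_const_left _ (u 0) (tendsto_id.const_mul_atBot hm))
    filter_upwards [eventually_le_atBot 0] with t ht
    have := hmono2 ht
    simp only [id_eq] at *
    linarith
  have hsurj := hcont.surjective htop hbot
  set e := hmono.orderIsoOfSurjective u hsurj with he
  have h1 : ∀ s, u (e.symm s) = s := fun s => e.apply_symm_apply s
  refine ⟨e.symm, h1, fun t => e.symm_apply_apply t, fun s => ?_⟩
  exact HasDerivAt.of_local_left_inverse e.symm.continuous.continuousAt (hu _)
    (hm.trans_le (hv _)).ne' (Eventually.of_forall h1)

theorem exists_bounds_of_periodic {v : ℝ → ℝ} {T : ℝ} (hT : 0 < T) (hv : Continuous v)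
    (hper : Function.Periodic v T) (hpos : ∀ t, 0 < v t) :
    ∃ m M : ℝ, 0 < m ∧ ∀ t, m ≤ v t ∧ v t ≤ M := by
  obtain ⟨a, -, ha⟩ := (isCompact_Icc (a := (0 : ℝ)) (b := T)).exists_isMinOn
    ⟨0, le_rfl, hT.le⟩ hv.continuousOn
  obtain ⟨b, -, hb⟩ := (isCompact_Icc (a := (0 : ℝ)) (b := T)).exists_isMaxOn
    ⟨0, le_rfl, hT.le⟩ hv.continuousOn
  refine ⟨v a, v b, hpos a, fun t => ?_⟩
  obtain ⟨y, hy, hty⟩ := hper.exists_mem_Ico₀ hT t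
  rw [hty]
  exact ⟨ha (Ico_subset_Icc_self hy), hb (Ico_subset_Icc_self hy)⟩

theorem exists_cos_sin {c s : ℝ} (h : c ^ 2 + s ^ 2 = 1) : ∃ θ, c = Real.cos θ ∧ s = Real.sin θ := by
  have hc : -1 ≤ c ∧ c ≤ 1 := by constructor <;> nlinarith [sq_nonneg s]
  have h1 : √(1 - c ^ 2) = |s| := by
    rw [← h, add_sub_cancel_left, Real.sqrt_sq_eq_abs]
  rcases le_total 0 s with hs | hs
  · refine ⟨Real.arccos c, (Real.cos_arccos hc.1 hc.2).symm, ?_⟩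
    rw [Real.sin_arccos, h1, abs_of_nonneg hs]
  · refine ⟨-Real.arccos c, by rw [Real.cos_neg, Real.cos_arccos hc.1 hc.2], ?_⟩
    rw [Real.sin_neg, Real.sin_arccos, h1, abs_of_nonpos hs, neg_neg]

/-- Polar-type coordinates `(r, θ)` on the part `α < h < β` of an open set `W`, in which the flow
of `V ε` reads `r' = ε A`, `θ' = Ω ε`. The functions `c` and `s` are `cos θ` and `sin θ`. -/
structure PolarChart (V : ℝ → ℝ × ℝ → ℝ × ℝ) (W : Set (ℝ × ℝ)) (α β : ℝ) (h : ℝ × ℝ → ℝ) where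
  Φ : ℝ → ℝ → ℝ × ℝ
  c : ℝ × ℝ → ℝ
  s : ℝ × ℝ → ℝ
  A : ℝ × ℝ → ℝ
  Ω : ℝ → ℝ × ℝ → ℝ
  isOpen : IsOpen W
  continuous_h : ContinuousOn h W
  continuous_Ω : ∀ ε, ContinuousOn (Ω ε) {p | p ∈ W ∧ h p ∈ Ioo α β}
  sq_add_sq : ∀ p ∈ W, h p ∈ Ioo α β → c p ^ 2 + s p ^ 2 = 1
  map_mem : ∀ r ∈ Ioo α β, ∀ θ, Φ r θ ∈ W
  h_map : ∀ r ∈ Ioo α β, ∀ θ, h (Φ r θ) = r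
  c_map : ∀ r ∈ Ioo α β, ∀ θ, c (Φ r θ) = Real.cos θ
  s_map : ∀ r ∈ Ioo α β, ∀ θ, s (Φ r θ) = Real.sin θ
  map_periodic : ∀ r θ, Φ r (θ + 2 * Real.pi) = Φ r θ
  map_eq : ∀ p ∈ W, h p ∈ Ioo α β → ∀ θ, c p = Real.cos θ → s p = Real.sin θ → Φ (h p) θ = p
  Ω_pos : ∀ r ∈ Ioo α β, ∀ θ, 0 < Ω 0 (Φ r θ)
  contDiff_A : ∀ r ∈ Ioo α β, ∀ θ, ∀ ε,
    ContDiffAt ℝ 1 (fun q : (ℝ × ℝ) × ℝ => A (Φ q.1.2 q.2)) ((ε, r), θ)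
  contDiff_Ω : ∀ r ∈ Ioo α β, ∀ θ, ∀ ε,
    ContDiffAt ℝ 1 (fun q : (ℝ × ℝ) × ℝ => Ω q.1.1 (Φ q.1.2 q.2)) ((ε, r), θ)
  flow : ∀ ε (γ : ℝ → ℝ × ℝ) t, γ t ∈ W → h (γ t) ∈ Ioo α β → HasDerivAt γ (V ε (γ t)) t →
    HasDerivAt (fun t => h (γ t)) (ε * A (γ t)) t ∧
    HasDerivAt (fun t => c (γ t)) (-(s (γ t) * Ω ε (γ t))) t ∧
    HasDerivAt (fun t => s (γ t)) (c (γ t) * Ω ε (γ t)) t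
  lift : ∀ ε (r θ : ℝ → ℝ) t, r t ∈ Ioo α β → HasDerivAt r (ε * A (Φ (r t) (θ t))) t →
    HasDerivAt θ (Ω ε (Φ (r t) (θ t))) t →
    HasDerivAt (fun t => Φ (r t) (θ t)) (V ε (Φ (r t) (θ t))) t

namespace PolarChart

variable {V : ℝ → ℝ × ℝ → ℝ × ℝ} {W : Set (ℝ × ℝ)} {α β : ℝ} {h : ℝ × ℝ → ℝ}

/-- The right hand side of the equation `dr/dθ = ε F`. -/
noncomputable def F (P : PolarChart V W α β h) (q : (ℝ × ℝ) × ℝ) : ℝ :=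
  P.A (P.Φ q.1.2 q.2) / P.Ω q.1.1 (P.Φ q.1.2 q.2)

theorem exists_periodic_orbit (P : PolarChart V W α β h) {ε : ℝ} {ρ : ℝ → ℝ}
    (hρ : ∀ θ, ρ θ ∈ Ioo α β) (hρd : ∀ θ, HasDerivAt ρ (ε * P.F ((ε, ρ θ), θ)) θ)
    (hρp : Function.Periodic ρ (2 * Real.pi)) (hΩ : ∀ θ, 0 < P.Ω ε (P.Φ (ρ θ) θ)) :
    ∃ γ : ℝ → ℝ × ℝ,
      (∀ t : ℝ, HasDerivAt γ (V ε (γ t)) t) ∧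
      (∃ T : ℝ, 0 < T ∧ Function.Periodic γ T) ∧
      (∃ t₁ t₂ : ℝ, γ t₁ ≠ γ t₂) ∧
      range (fun θ => P.Φ (ρ θ) θ) = range γ := by
  set ω : ℝ → ℝ := fun θ => P.Ω ε (P.Φ (ρ θ) θ) with hω
  have hρc : Continuous ρ := continuous_iff_continuousAt.2 fun t => (hρd t).continuousAt
  have hωc : Continuous ω := continuous_iff_continuousAt.2 fun θ =>
    ContinuousAt.comp (f := fun θ : ℝ => (((ε, ρ θ), θ) : (ℝ × ℝ) × ℝ))
      (P.contDiff_Ω (ρ θ) (hρ θ) θ ε).continuousAt (by fun_prop)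
  have hωp : Function.Periodic ω (2 * Real.pi) := fun θ => by
    simp only [hω, hρp θ, P.map_periodic]
  obtain ⟨m, M, hm, hmM⟩ := exists_bounds_of_periodic Real.two_pi_pos hωc hωp hΩ
  have hM : 0 < M := hm.trans_le ((hmM 0).1.trans (hmM 0).2)
  have hinv : Continuous fun θ => (ω θ)⁻¹ := hωc.inv₀ fun θ => (hΩ θ).ne'
  set u : ℝ → ℝ := fun θ => ∫ x in (0 : ℝ)..θ, (ω x)⁻¹ with hu
  obtain ⟨w, h1, h2, h3⟩ := exists_inverse_of_deriv_ge (u := u) (v := fun θ => (ω θ)⁻¹)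
    (m := M⁻¹) (fun θ => (hinv.integral_hasStrictDerivAt 0 θ).hasDerivAt) (by positivity)
    (fun θ => inv_anti₀ (hΩ θ) (hmM θ).2)
  have hup : ∀ θ, u (θ + 2 * Real.pi) = u θ + u (2 * Real.pi) := fun θ => by
    have hp : Function.Periodic (fun θ => (ω θ)⁻¹) (2 * Real.pi) := fun θ => by simp only [hωp θ]
    simp only [hu]
    rw [← intervalIntegral.integral_add_adjacent_intervals (b := θ)
      (hinv.intervalIntegrable _ _) (hinv.intervalIntegrable _ _),
      hp.intervalIntegral_add_eq θ 0, zero_add]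
  have hwp : ∀ t, w (t + u (2 * Real.pi)) = w t + 2 * Real.pi := fun t => by
    rw [← h2 (w t + 2 * Real.pi), hup, h1]
  have hupos : 0 < u (2 * Real.pi) :=
    intervalIntegral.intervalIntegral_pos_of_pos (hinv.intervalIntegrable _ _)
      (fun θ => inv_pos.2 (hΩ θ)) Real.two_pi_pos
  refine ⟨fun t => P.Φ (ρ (w t)) (w t), fun t => ?_, ⟨u (2 * Real.pi), hupos, fun t => ?_⟩,
    ⟨u 0, u Real.pi, fun heq => ?_⟩, ?_⟩
  · have h4 : HasDerivAt w (ω (w t)) t := (h3 t).congr_deriv (inv_inv _)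
    refine P.lift ε (fun t => ρ (w t)) w t (hρ _) ?_ h4
    refine ((hρd (w t)).comp t h4).congr_deriv ?_
    simp only [F, hω]
    have := (hΩ (w t)).ne'
    field_simp
  · simp only [hwp, hρp _, P.map_periodic]
  · simp only [h2] at heq
    have := congrArg P.c heq
    rw [P.c_map _ (hρ _), P.c_map _ (hρ _), Real.cos_zero, Real.cos_pi] at this
    norm_num at this
  · ext p
    constructor
    · rintro ⟨θ, rfl⟩
      exact ⟨u θ, by simp only [h2]⟩
    · rintro ⟨t, rfl⟩
      exact ⟨w t, rfl⟩

/-- A periodic orbit inside the chart is the graph of a periodic solution of `dr/dθ = ε F`. -/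
theorem exists_polar_form (P : PolarChart V W α β h) {ε T : ℝ} {γ : ℝ → ℝ × ℝ}
    (hγ : ∀ t, HasDerivAt γ (V ε (γ t)) t) (hT : 0 < T) (hγT : Function.Periodic γ T)
    (hW : ∀ t, γ t ∈ W) (hI : ∀ t, h (γ t) ∈ Ioo α β) (hΩ : ∀ t, 0 < P.Ω ε (γ t)) :
    ∃ (ρ : ℝ → ℝ) (k : ℕ), 1 ≤ k ∧ (∀ θ, ∃ t, ρ θ = h (γ t)) ∧
      (∀ θ, HasDerivAt ρ (ε * P.F ((ε, ρ θ), θ)) θ) ∧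
      Function.Periodic ρ (k * (2 * Real.pi)) ∧ range γ = range (fun θ => P.Φ (ρ θ) θ) := by
  have hγc : Continuous γ := continuous_iff_continuousAt.2 fun t => (hγ t).continuousAt
  set v : ℝ → ℝ := fun t => P.Ω ε (γ t) with hv
  have hvc : Continuous v := (P.continuous_Ω ε).comp_continuous hγc fun t => ⟨hW t, hI t⟩
  have hvp : Function.Periodic v T := fun t => by simp only [hv, hγT t]
  obtain ⟨m, M, hm, hmM⟩ := exists_bounds_of_periodic hT hvc hvp hΩ
  obtain ⟨θ₀, hc0, hs0⟩ := exists_cos_sin (P.sq_add_sq _ (hW 0) (hI 0))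
  set u : ℝ → ℝ := fun t => θ₀ + ∫ x in (0 : ℝ)..t, v x with hu
  have hud : ∀ t, HasDerivAt u (v t) t := fun t =>
    ((hvc.integral_hasStrictDerivAt 0 t).hasDerivAt).const_add θ₀
  have hflow := fun t => P.flow ε γ t (hW t) (hI t) (hγ t)
  have hconst : ∀ f : ℝ → ℝ, (∀ t, HasDerivAt f 0 t) → ∀ t, f t = f 0 := fun f hf t =>
    is_const_of_deriv_eq_zero (fun t => (hf t).differentiableAt) (fun t => (hf t).deriv) t 0
  have hq1 := hconst (fun t => P.c (γ t) * Real.cos (u t) + P.s (γ t) * Real.sin (u t))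
    (fun t => (((hflow t).2.1.fun_mul (hud t).cos).fun_add
      ((hflow t).2.2.fun_mul (hud t).sin)).congr_deriv (by simp only [hv]; ring))
  have hq2 := hconst (fun t => P.s (γ t) * Real.cos (u t) - P.c (γ t) * Real.sin (u t))
    (fun t => (((hflow t).2.2.fun_mul (hud t).cos).fun_sub
      ((hflow t).2.1.fun_mul (hud t).sin)).congr_deriv (by simp only [hv]; ring))
  have hu0 : u 0 = θ₀ := by simp [hu]
  simp only [hu0, hc0, hs0] at hq1 hq2
  have hcs : ∀ t, P.c (γ t) = Real.cos (u t) ∧ P.s (γ t) = Real.sin (u t) := fun t => by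
    have e1 := hq1 t
    have e2 := hq2 t
    have e3 := Real.sin_sq_add_cos_sq (u t)
    have e4 := Real.sin_sq_add_cos_sq θ₀
    constructor
    · linear_combination Real.cos (u t) * e1 - Real.sin (u t) * e2 -
        P.c (γ t) * e3 + Real.cos (u t) * e4
    · linear_combination Real.sin (u t) * e1 + Real.cos (u t) * e2 -
        P.s (γ t) * e3 + Real.sin (u t) * e4
  obtain ⟨w, h1, h2, h3⟩ := exists_inverse_of_deriv_ge hud hm (fun t => (hmM t).1)
  have hut : ∀ t, u (t + T) = u t + (u T - θ₀) := fun t => by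
    simp only [hu]
    rw [← intervalIntegral.integral_add_adjacent_intervals (b := t)
      (hvc.intervalIntegrable _ _) (hvc.intervalIntegrable _ _),
      hvp.intervalIntegral_add_eq t 0, zero_add]
    ring
  have huT : 0 < u T - θ₀ := by
    simp only [hu, add_sub_cancel_left]
    exact intervalIntegral.intervalIntegral_pos_of_pos (hvc.intervalIntegrable _ _) hΩ hT
  have hang : ((u T : ℝ) : Real.Angle) = (θ₀ : Real.Angle) := by
    have hT0 : γ T = γ 0 := by simpa using hγT 0
    have e1 := hcs T
    rw [hT0, hc0, hs0] at e1
    exact Real.Angle.cos_sin_inj e1.1.symm e1.2.symm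
  obtain ⟨k, hk⟩ := Real.Angle.angle_eq_iff_two_pi_dvd_sub.1 hang
  have hkpos : 0 < k := by
    have : (0 : ℝ) < k := by
      by_contra hneg
      push Not at hneg
      rw [hk] at huT
      nlinarith [Real.pi_pos]
    exact_mod_cast this
  lift k to ℕ using hkpos.le
  have hwp : ∀ s, w (s + k * (2 * Real.pi)) = w s + T := fun s => by
    rw [← h2 (w s + T), hut, h1, hk]
    congr 1
    push_cast
    ring
  have hΦ : ∀ θ, P.Φ (h (γ (w θ))) θ = γ (w θ) := fun θ => by
    have e1 := hcs (w θ)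
    rw [h1] at e1
    exact P.map_eq _ (hW _) (hI _) θ e1.1 e1.2
  refine ⟨fun θ => h (γ (w θ)), k, by exact_mod_cast hkpos, fun θ => ⟨w θ, rfl⟩, fun θ => ?_,
    fun θ => ?_, ?_⟩
  · refine ((hflow (w θ)).1.comp θ (h3 θ)).congr_deriv ?_
    simp only [F, hΦ, hv]
    ring
  · simp only [hwp, hγT _]
  · ext p
    constructor
    · rintro ⟨t, rfl⟩
      refine ⟨u t, ?_⟩
      exact (hΦ (u t)).trans (congrArg γ (h2 t))
    · rintro ⟨θ, rfl⟩
      exact ⟨w θ, (hΦ θ).symm⟩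

theorem contDiffAt_F (P : PolarChart V W α β h) {r : ℝ} (hr : r ∈ Ioo α β) (θ : ℝ) :
    ContDiffAt ℝ 1 P.F ((0, r), θ) :=
  (P.contDiff_A r hr θ 0).div (P.contDiff_Ω r hr θ 0) (P.Ω_pos r hr θ).ne'

theorem F_periodic (P : PolarChart V W α β h) (p : ℝ × ℝ) (θ : ℝ) :
    P.F (p, θ + 2 * Real.pi) = P.F (p, θ) := by
  simp only [F, P.map_periodic]

/-- A simple zero of the averaged function gives a limit cycle for all small `ε > 0`. -/
theorem eventually_exists_isLimitCycle (P : PolarChart V W α β h) {r₀ d ζ : ℝ}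
    (hr : r₀ ∈ Ioo α β) (h0 : ∫ θ in (0 : ℝ)..2 * Real.pi, P.F ((0, r₀), θ) = 0)
    (hd : HasDerivAt (fun x => ∫ θ in (0 : ℝ)..2 * Real.pi, P.F ((0, x), θ)) d r₀) (hd0 : d ≠ 0)
    (hζ : 0 < ζ) :
    ∀ᶠ ε in 𝓝[>] (0 : ℝ), ∃ Γ, IsLimitCycle (V ε) Γ ∧ ∀ p ∈ Γ, p ∈ W ∧ |h p - r₀| < ζ := by
  have hpos : ∀ᶠ q in 𝓝 ((0 : ℝ), r₀), ∀ θ ∈ Icc 0 (2 * Real.pi), 0 < P.Ω q.1 (P.Φ q.2 θ) :=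
    isCompact_Icc.eventually_forall_of_forall_eventually fun θ _ =>
      (P.contDiff_Ω r₀ hr θ 0).continuousAt.eventually_const_lt (P.Ω_pos r₀ hr θ)
  obtain ⟨τ, hτ, hbox⟩ := Metric.eventually_nhds_iff.1 hpos
  have hboxpos : ∀ ε r, |ε| < τ → |r - r₀| < τ → ∀ θ, 0 < P.Ω ε (P.Φ r θ) := fun ε r h1 h2 θ => by
    have hper : Function.Periodic (fun θ => P.Φ r θ) (2 * Real.pi) := P.map_periodic r
    obtain ⟨y, hy, hty⟩ := hper.exists_mem_Ico₀ Real.two_pi_pos θ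
    rw [hty]
    refine hbox (y := (ε, r)) ?_ y (Ico_subset_Icc_self hy)
    rw [Prod.dist_eq]
    exact max_lt (by simpa [Real.dist_eq] using h1) (by simpa [Real.dist_eq] using h2)
  set ζ' := min (min ζ τ) (min (r₀ - α) (β - r₀)) with hζ'
  have hζ'0 : 0 < ζ' :=
    lt_min (lt_min hζ hτ) (lt_min (sub_pos.2 hr.1) (sub_pos.2 hr.2))
  have hz1 : ζ' ≤ ζ := (min_le_left _ _).trans (min_le_left _ _)
  have hz2 : ζ' ≤ τ := (min_le_left _ _).trans (min_le_right _ _)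
  have hz3 : ζ' ≤ r₀ - α := (min_le_right _ _).trans (min_le_left _ _)
  have hz4 : ζ' ≤ β - r₀ := (min_le_right _ _).trans (min_le_right _ _)
  obtain ⟨η, hη, hηζ, hav⟩ := averaging Real.two_pi_pos (fun θ => P.contDiffAt_F hr θ)
    P.F_periodic h0 hd hd0 hζ'0
  have hmem : ∀ r, |r - r₀| < η → r ∈ Ioo α β := fun r h1 => by
    have := abs_lt.1 h1
    constructor <;> linarith
  have hετ : ∀ᶠ ε in 𝓝[>] (0 : ℝ), ε < τ := mem_nhdsWithin_of_mem_nhds (Iio_mem_nhds hτ)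
  filter_upwards [hav, hετ, self_mem_nhdsWithin] with ε ⟨ρ, h1, h2, h3, h4⟩ h5 h6
  have h5 : |ε| < τ := by rwa [abs_of_pos h6]
  obtain ⟨γ, g1, g2, g3, g4⟩ := P.exists_periodic_orbit (fun θ => hmem _ (h1 θ)) h2 h3
    fun θ => hboxpos _ _ h5 ((h1 θ).trans (by linarith)) θ
  have hΓ : ∀ p ∈ range (fun θ => P.Φ (ρ θ) θ), p ∈ W ∧ |h p - r₀| < η := by
    rintro _ ⟨θ, rfl⟩
    refine ⟨P.map_mem _ (hmem _ (h1 θ)) θ, ?_⟩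
    simp only [P.h_map _ (hmem _ (h1 θ)) θ]
    exact h1 θ
  refine ⟨range fun θ => P.Φ (ρ θ) θ, ⟨⟨γ, g1, g2, g3, g4⟩,
    {p | p ∈ W ∧ |h p - r₀| < η}, ?_, fun p hp => hΓ p hp, ?_⟩,
    fun p hp => ⟨(hΓ p hp).1, (hΓ p hp).2.trans (by linarith)⟩⟩
  · have := (P.continuous_h.sub (continuousOn_const (c := r₀))).abs.isOpen_inter_preimage P.isOpen
      (isOpen_Iio (a := η))
    exact this
  · rintro Γ' ⟨γ', k1, ⟨T, hT, k2⟩, -, rfl⟩ hsub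
    have hsub' : ∀ t, γ' t ∈ W ∧ |h (γ' t) - r₀| < η := fun t => hsub ⟨t, rfl⟩
    have hI : ∀ t, h (γ' t) ∈ Ioo α β := fun t => hmem _ (hsub' t).2
    obtain ⟨ρ', k, e1, e2, e3, e4, e5⟩ := P.exists_polar_form k1 hT k2 (fun t => (hsub' t).1) hI
      (fun t => by
        obtain ⟨θ, hc, hs⟩ := exists_cos_sin (P.sq_add_sq _ (hsub' t).1 (hI t))
        rw [← P.map_eq _ (hsub' t).1 (hI t) θ hc hs]
        exact hboxpos _ _ h5 ((hsub' t).2.trans (by linarith)) θ)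
    rw [e5, h4 ρ' k e1 (fun θ => by
      obtain ⟨t, ht⟩ := e2 θ
      rw [ht]
      exact (hsub' t).2) e3 e4]

end PolarChart

/-- The energy-like radius `√((x² - μ)² + 2 y²)` of the potential `(x² - μ)² / 4`. -/
noncomputable def duffingRadius (μ : ℝ) (p : ℝ × ℝ) : ℝ := √((p.1 ^ 2 - μ) ^ 2 + 2 * p.2 ^ 2)

theorem continuous_duffingRadius (μ : ℝ) : Continuous (duffingRadius μ) := by
  unfold duffingRadius; fun_prop

theorem duffingRadius_sq (μ : ℝ) (p : ℝ × ℝ) :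
    duffingRadius μ p ^ 2 = (p.1 ^ 2 - μ) ^ 2 + 2 * p.2 ^ 2 := Real.sq_sqrt (by positivity)

theorem contDiffAt_duffingRadius {μ : ℝ} {p : ℝ × ℝ} (hp : 0 < duffingRadius μ p) :
    ContDiffAt ℝ 1 (duffingRadius μ) p := by
  have h : (p.1 ^ 2 - μ) ^ 2 + 2 * p.2 ^ 2 ≠ 0 := (Real.sqrt_pos.1 hp).ne'
  exact ContDiffAt.sqrt (by fun_prop) h

theorem contDiff_eval (f : ℝ[X]) : ContDiff ℝ 1 fun x => f.eval x :=
  by simpa using f.contDiff_aeval (𝕜 := ℝ) 1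

theorem eval_duffing (μ x : ℝ) : (X ^ 3 - C μ * X : ℝ[X]).eval x = x ^ 3 - μ * x := by simp

theorem hasDerivAt_duffingRadius {f : ℝ[X]} {μ ε : ℝ} {γ : ℝ → ℝ × ℝ} {t : ℝ}
    (hγ : HasDerivAt γ (lienard f (X ^ 3 - C μ * X) ε (γ t)) t) (hp : 0 < duffingRadius μ (γ t)) :
    HasDerivAt (fun t => duffingRadius μ (γ t))
      (ε * -(f.eval (γ t).1 * (2 * (γ t).2 ^ 2) / duffingRadius μ (γ t))) t := by
  have h : ((γ t).1 ^ 2 - μ) ^ 2 + 2 * (γ t).2 ^ 2 ≠ 0 := (Real.sqrt_pos.1 hp).ne'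
  have h1 : HasDerivAt (fun t => (γ t).1) (γ t).2 t := hγ.fst
  have h2 : HasDerivAt (fun t => (γ t).2) _ t := hγ.snd
  have h3 := ((((h1.fun_pow 2).sub_const μ).fun_pow 2).fun_add ((h2.fun_pow 2).const_mul 2)).sqrt h
  refine h3.congr_deriv ?_
  have h4 : duffingRadius μ (γ t) = √(((γ t).1 ^ 2 - μ) ^ 2 + 2 * (γ t).2 ^ 2) := rfl
  rw [← h4]
  simp only [lienard, eval_duffing]
  field_simp
  push_cast
  ring

theorem sqrt_two_sq : √(2 : ℝ) ^ 2 = 2 := Real.sq_sqrt (by norm_num)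

theorem well_arg_pos {μ r : ℝ} (hr : r ∈ Ioo 0 μ) (θ : ℝ) : 0 < μ + r * Real.cos θ := by
  nlinarith [Real.neg_one_le_cos θ, hr.1, hr.2]

theorem duffingRadius_well {μ σ r : ℝ} (hσ : σ ^ 2 = 1) (hr : r ∈ Ioo 0 μ) (θ : ℝ) :
    duffingRadius μ (σ * √(μ + r * Real.cos θ), -(σ * r * Real.sin θ / √2)) = r := by
  unfold duffingRadius
  rw [show ((σ * √(μ + r * Real.cos θ)) ^ 2 - μ) ^ 2 + 2 * (-(σ * r * Real.sin θ / √2)) ^ 2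
      = r ^ 2 by
    rw [mul_pow, Real.sq_sqrt (well_arg_pos hr θ).le, neg_sq, div_pow, mul_pow, mul_pow,
      sqrt_two_sq, hσ]
    linear_combination r ^ 2 * Real.sin_sq_add_cos_sq θ]
  exact Real.sqrt_sq hr.1.le

/-- Polar coordinates inside one of the two wells (`σ = ±1`) of the potential `(x² - μ)² / 4`. -/
noncomputable def wellChart (f : ℝ[X]) {μ σ : ℝ} (hσ : σ ^ 2 = 1) :
    PolarChart (lienard f (X ^ 3 - C μ * X)) {p | 0 < σ * p.1} 0 μ (duffingRadius μ) where
  Φ r θ := (σ * √(μ + r * Real.cos θ), -(σ * r * Real.sin θ / √2))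
  c p := (p.1 ^ 2 - μ) / duffingRadius μ p
  s p := -(√2 * σ * p.2) / duffingRadius μ p
  A p := -(f.eval p.1 * (2 * p.2 ^ 2) / duffingRadius μ p)
  Ω ε p := √2 * σ * p.1 +
    ε * (f.eval p.1 * (p.1 ^ 2 - μ) * (√2 * σ * p.2) / duffingRadius μ p ^ 2)
  isOpen := isOpen_lt (by fun_prop) (by fun_prop)
  continuous_h := (continuous_duffingRadius μ).continuousOn
  continuous_Ω ε := by
    have h1 := (continuous_duffingRadius μ)
    have h2 : Continuous fun p : ℝ × ℝ => f.eval p.1 := f.continuous.comp continuous_fst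
    refine ContinuousOn.add (by fun_prop) (continuousOn_const.mul
      (ContinuousOn.div (by fun_prop) (by fun_prop) fun p hp => ?_))
    exact pow_ne_zero _ hp.2.1.ne'
  sq_add_sq p _ hp := by
    have h1 := duffingRadius_sq μ p
    have h2 := hp.1.ne'
    rw [div_pow, div_pow, ← add_div, div_eq_one_iff_eq (pow_ne_zero _ h2), h1, neg_sq, mul_pow,
      mul_pow, sqrt_two_sq, hσ]
    ring
  map_mem r hr θ := by
    have h1 := Real.sqrt_pos.2 (well_arg_pos hr θ)
    simp only [mem_ofPred_eq]
    rw [← mul_assoc, ← sq, hσ, one_mul]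
    exact h1
  h_map r hr θ := duffingRadius_well hσ hr θ
  c_map r hr θ := by
    simp only [duffingRadius_well hσ hr θ]
    rw [mul_pow, Real.sq_sqrt (well_arg_pos hr θ).le, hσ]
    have := hr.1.ne'
    field_simp
    ring
  s_map r hr θ := by
    simp only [duffingRadius_well hσ hr θ]
    have := hr.1.ne'
    have h2 : √(2 : ℝ) ≠ 0 := by positivity
    field_simp
    rw [hσ, one_mul]
  map_periodic r θ := by simp only [Real.cos_add_two_pi, Real.sin_add_two_pi]
  map_eq p hp hI θ hc hs := by
    have h0 := hI.1.ne'
    rw [div_eq_iff h0] at hc hs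
    have e1 : μ + duffingRadius μ p * Real.cos θ = (σ * p.1) ^ 2 := by
      rw [mul_pow, hσ]; linarith
    have e2 : σ * duffingRadius μ p * Real.sin θ = -(√2 * p.2) := by
      linear_combination (-σ) * hs - √2 * p.2 * hσ
    have h2 : √(2 : ℝ) ≠ 0 := by positivity
    have hp : 0 < σ * p.1 := hp
    rw [e1, e2, Real.sqrt_sq hp.le]
    refine Prod.ext ?_ ?_
    · simp only
      linear_combination p.1 * hσ
    · simp only
      field_simp
  Ω_pos r hr θ := by
    have h1 := Real.sqrt_pos.2 (well_arg_pos hr θ)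
    have h2 : 0 < √(2 : ℝ) := by positivity
    simp only [zero_mul, add_zero]
    rw [mul_assoc, ← mul_assoc σ, ← sq, hσ, one_mul]
    exact mul_pos h2 h1
  contDiff_A r hr θ ε := by
    have h1 : ContDiffAt ℝ 1 (fun q : (ℝ × ℝ) × ℝ => ((σ * √(μ + q.1.2 * Real.cos q.2),
        -(σ * q.1.2 * Real.sin q.2 / √2)) : ℝ × ℝ)) ((ε, r), θ) := by
      have h2 : ContDiffAt ℝ 1 (fun q : (ℝ × ℝ) × ℝ => √(μ + q.1.2 * Real.cos q.2)) ((ε, r), θ) :=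
        ContDiffAt.sqrt (by fun_prop) (well_arg_pos hr θ).ne'
      fun_prop
    have h3 : ContDiffAt ℝ 1 (fun p : ℝ × ℝ => -(f.eval p.1 * (2 * p.2 ^ 2) / duffingRadius μ p))
        (σ * √(μ + r * Real.cos θ), -(σ * r * Real.sin θ / √2)) := by
      have h4 := duffingRadius_well hσ hr θ
      have h5 := contDiffAt_duffingRadius (h4.symm ▸ hr.1)
      have h6 : ContDiff ℝ 1 fun p : ℝ × ℝ => f.eval p.1 := (contDiff_eval f).comp contDiff_fst
      exact (ContDiffAt.div (by fun_prop) h5 (h4.symm ▸ hr.1.ne')).neg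
    exact h3.comp (f := fun q : (ℝ × ℝ) × ℝ => ((σ * √(μ + q.1.2 * Real.cos q.2),
        -(σ * q.1.2 * Real.sin q.2 / √2)) : ℝ × ℝ)) ((ε, r), θ) h1
  contDiff_Ω r hr θ ε := by
    have h1 : ContDiffAt ℝ 1 (fun q : (ℝ × ℝ) × ℝ => (((σ * √(μ + q.1.2 * Real.cos q.2),
        -(σ * q.1.2 * Real.sin q.2 / √2)), q.1.1) : (ℝ × ℝ) × ℝ)) ((ε, r), θ) := by
      have h2 : ContDiffAt ℝ 1 (fun q : (ℝ × ℝ) × ℝ => √(μ + q.1.2 * Real.cos q.2)) ((ε, r), θ) :=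
        ContDiffAt.sqrt (by fun_prop) (well_arg_pos hr θ).ne'
      fun_prop
    have h3 : ContDiffAt ℝ 1 (fun z : (ℝ × ℝ) × ℝ => √2 * σ * z.1.1 + z.2 *
        (f.eval z.1.1 * (z.1.1 ^ 2 - μ) * (√2 * σ * z.1.2) / duffingRadius μ z.1 ^ 2))
        ((σ * √(μ + r * Real.cos θ), -(σ * r * Real.sin θ / √2)), ε) := by
      have h4 := duffingRadius_well hσ hr θ
      have h5 : ContDiffAt ℝ 1 (fun z : (ℝ × ℝ) × ℝ => duffingRadius μ z.1)
          ((σ * √(μ + r * Real.cos θ), -(σ * r * Real.sin θ / √2)), ε) :=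
        ContDiffAt.comp (g := duffingRadius μ) _ (contDiffAt_duffingRadius (h4.symm ▸ hr.1))
          contDiffAt_fst
      have h6 : ContDiff ℝ 1 fun z : (ℝ × ℝ) × ℝ => f.eval z.1.1 :=
        (contDiff_eval f).comp (contDiff_fst.comp contDiff_fst)
      exact ContDiffAt.add (by fun_prop) (contDiffAt_snd.mul (ContDiffAt.div (by fun_prop)
        (h5.pow 2) (by simp only [h4]; exact pow_ne_zero _ hr.1.ne')))
    exact h3.comp (f := fun q : (ℝ × ℝ) × ℝ => (((σ * √(μ + q.1.2 * Real.cos q.2),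
        -(σ * q.1.2 * Real.sin q.2 / √2)), q.1.1) : (ℝ × ℝ) × ℝ)) ((ε, r), θ) h1
  flow ε γ t hW hI hγ := by
    have h0 := hI.1.ne'
    have hr := hasDerivAt_duffingRadius hγ hI.1
    have h1 : HasDerivAt (fun t => (γ t).1) (γ t).2 t := hγ.fst
    have h2 : HasDerivAt (fun t => (γ t).2) _ t := hγ.snd
    have hsq := duffingRadius_sq μ (γ t)
    have hs2 := sqrt_two_sq
    refine ⟨hr, ?_, ?_⟩
    · refine (((h1.fun_pow 2).sub_const μ).fun_div hr h0).congr_deriv ?_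
      set R := duffingRadius μ (γ t)
      field_simp
      push_cast
      rw [hs2, hσ]
      ring
    · refine ((h2.const_mul (√2 * σ)).fun_neg.fun_div hr h0).congr_deriv ?_
      simp only [lienard, eval_duffing]
      set R := duffingRadius μ (γ t)
      field_simp
      linear_combination σ * ε * f.eval (γ t).1 * (γ t).2 * hsq
  lift ε r θ t hI hr hθ := by
    have h0 := hI.1.ne'
    have hpos := well_arg_pos hI (θ t)
    have hR := duffingRadius_well hσ hI (θ t)
    simp only [hR] at hr hθ
    have hX := (Real.sqrt_pos.2 hpos).ne'
    have hX2 := Real.sq_sqrt hpos.le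
    have hs2 := sqrt_two_sq
    have hs20 : √(2 : ℝ) ≠ 0 := by positivity
    have h1 := ((hr.fun_mul hθ.cos).const_add μ).sqrt hpos.ne' |>.const_mul σ
    have h2 := (((hr.const_mul σ).fun_mul hθ.sin).div_const √2).fun_neg
    refine (h1.prodMk h2).congr_deriv (Prod.ext ?_ ?_)
    · simp only [lienard]
      set Y := √(μ + r t * Real.cos (θ t))
      field_simp
      rw [hs2, hσ, hX2, show σ ^ 3 = σ by rw [pow_succ, hσ, one_mul]]
      ring
    · simp only [lienard, eval_duffing]
      set Y := √(μ + r t * Real.cos (θ t))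
      field_simp
      rw [hs2, hσ, hX2, show σ ^ 3 = σ by rw [pow_succ, hσ, one_mul]]
      linear_combination 2 * σ * ε * f.eval (σ * Y) * r t * Real.sin (θ t) *
        Real.sin_sq_add_cos_sq (θ t)

/-- The amplitude of the orbit through `p` of the potential `(x² - μ)² / 4`. -/
noncomputable def amplitude (μ : ℝ) (p : ℝ × ℝ) : ℝ := √(μ + duffingRadius μ p)

/-- The angular speed of the orbit of amplitude `a` at abscissa `x`. -/
noncomputable def angularSpeed (μ a x : ℝ) : ℝ := √((x ^ 2 + a ^ 2 - 2 * μ) / 2)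

theorem amplitude_sq {μ : ℝ} (hμ : 0 ≤ μ) (p : ℝ × ℝ) :
    amplitude μ p ^ 2 = μ + duffingRadius μ p :=
  Real.sq_sqrt (add_nonneg hμ (Real.sqrt_nonneg _))

theorem angularSpeed_arg_pos {μ a : ℝ} (hμ : μ ≤ 1 / 2) (ha : 1 < a) (x : ℝ) :
    0 < (x ^ 2 + a ^ 2 - 2 * μ) / 2 := by nlinarith [sq_nonneg x]

theorem angularSpeed_pos {μ a : ℝ} (hμ : μ ≤ 1 / 2) (ha : 1 < a) (x : ℝ) :
    0 < angularSpeed μ a x := Real.sqrt_pos.2 (angularSpeed_arg_pos hμ ha x)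

theorem angularSpeed_sq {μ a : ℝ} (hμ : μ ≤ 1 / 2) (ha : 1 < a) (x : ℝ) :
    angularSpeed μ a x ^ 2 = (x ^ 2 + a ^ 2 - 2 * μ) / 2 :=
  Real.sq_sqrt (angularSpeed_arg_pos hμ ha x).le

theorem continuous_amplitude (μ : ℝ) : Continuous (amplitude μ) :=
  (continuous_const.add (continuous_duffingRadius μ)).sqrt

theorem duffingRadius_of_amplitude {μ : ℝ} (hμ : 0 ≤ μ) (p : ℝ × ℝ) :
    duffingRadius μ p = amplitude μ p ^ 2 - μ := by rw [amplitude_sq hμ]; ring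

theorem sq_eq_of_amplitude {μ : ℝ} (hμ : 0 ≤ μ) (hμ2 : μ ≤ 1 / 2) {p : ℝ × ℝ}
    (hp : 1 < amplitude μ p) :
    p.2 ^ 2 = (amplitude μ p ^ 2 - p.1 ^ 2) * angularSpeed μ (amplitude μ p) p.1 ^ 2 := by
  have h1 := duffingRadius_sq μ p
  rw [duffingRadius_of_amplitude hμ] at h1
  rw [angularSpeed_sq hμ2 hp]
  linear_combination -1 / 2 * h1

theorem contDiffAt_amplitude {μ : ℝ} (hμ : 0 ≤ μ) (hμ2 : μ ≤ 1 / 2) {p : ℝ × ℝ}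
    (hp : 1 < amplitude μ p) : ContDiffAt ℝ 1 (amplitude μ) p := by
  have h1 := amplitude_sq hμ p
  have h2 : 0 < duffingRadius μ p := by nlinarith
  exact (contDiffAt_const.add (contDiffAt_duffingRadius h2)).sqrt (by positivity)

theorem amplitude_outer {μ a : ℝ} (hμ2 : μ ≤ 1 / 2) (ha : 1 < a) (θ : ℝ) :
    amplitude μ (a * Real.cos θ,
      -(a * Real.sin θ * angularSpeed μ a (a * Real.cos θ))) = a := by
  have h1 : duffingRadius μ (a * Real.cos θ,
      -(a * Real.sin θ * angularSpeed μ a (a * Real.cos θ))) = a ^ 2 - μ := by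
    unfold duffingRadius
    rw [← Real.sqrt_sq (show 0 ≤ a ^ 2 - μ by nlinarith)]
    congr 1
    simp only
    rw [neg_sq, mul_pow _ (angularSpeed _ _ _), angularSpeed_sq hμ2 ha]
    linear_combination (a ^ 2 * (a ^ 2 * Real.cos θ ^ 2 + a ^ 2 - 2 * μ)) * Real.sin_sq_add_cos_sq θ
  unfold amplitude
  rw [h1, add_sub_cancel]
  exact Real.sqrt_sq (by linarith)

theorem contDiffAt_outer {μ a : ℝ} (hμ2 : μ ≤ 1 / 2) (ha : 1 < a) (θ ε : ℝ) :
    ContDiffAt ℝ 1 (fun q : (ℝ × ℝ) × ℝ => (((q.1.2 * Real.cos q.2,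
      -(q.1.2 * Real.sin q.2 * angularSpeed μ q.1.2 (q.1.2 * Real.cos q.2))), q.1.1) :
        (ℝ × ℝ) × ℝ)) ((ε, a), θ) := by
  have h2 : ContDiffAt ℝ 1 (fun q : (ℝ × ℝ) × ℝ =>
      angularSpeed μ q.1.2 (q.1.2 * Real.cos q.2)) ((ε, a), θ) :=
    ContDiffAt.sqrt (by fun_prop) (angularSpeed_arg_pos hμ2 ha _).ne'
  fun_prop

/-- Polar coordinates outside the separatrix loops of the potential `(x² - μ)² / 4`. -/
noncomputable def outerChart (f : ℝ[X]) {μ : ℝ} (hμ : 0 ≤ μ) (hμ2 : μ ≤ 1 / 2) (β : ℝ) :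
    PolarChart (lienard f (X ^ 3 - C μ * X)) univ 1 β (amplitude μ) where
  Φ a θ := (a * Real.cos θ, -(a * Real.sin θ * angularSpeed μ a (a * Real.cos θ)))
  c p := p.1 / amplitude μ p
  s p := -p.2 / (amplitude μ p * angularSpeed μ (amplitude μ p) p.1)
  A p := -(f.eval p.1 * p.2 ^ 2 / (amplitude μ p * (amplitude μ p ^ 2 - μ)))
  Ω ε p := angularSpeed μ (amplitude μ p) p.1 +
    ε * (f.eval p.1 * p.1 * p.2 * angularSpeed μ (amplitude μ p) p.1 /
      (amplitude μ p ^ 2 * (amplitude μ p ^ 2 - μ)))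
  isOpen := isOpen_univ
  continuous_h := (continuous_amplitude μ).continuousOn
  continuous_Ω ε := by
    have h1 := continuous_amplitude μ
    have h2 : Continuous fun p : ℝ × ℝ => f.eval p.1 := f.continuous.comp continuous_fst
    have h3 : Continuous fun p => angularSpeed μ (amplitude μ p) p.1 := by
      unfold angularSpeed; fun_prop
    refine ContinuousOn.add h3.continuousOn (continuousOn_const.mul
      (ContinuousOn.div (((h2.mul continuous_fst).mul continuous_snd).mul h3).continuousOn
        (by fun_prop) fun p hp => ?_))
    have h4 : 1 < amplitude μ p := hp.2.1
    have h5 : 0 < amplitude μ p ^ 2 - μ := by nlinarith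
    positivity
  sq_add_sq p _ hp := by
    have h1 := sq_eq_of_amplitude hμ hμ2 hp.1
    have h2 := angularSpeed_pos hμ2 hp.1 p.1
    have h3 : 0 < amplitude μ p := one_pos.trans hp.1
    rw [div_pow, div_pow, neg_sq, mul_pow, h1]
    field_simp
    ring
  map_mem _ _ _ := mem_univ _
  h_map r hr θ := amplitude_outer hμ2 hr.1 θ
  c_map r hr θ := by
    simp only [amplitude_outer hμ2 hr.1 θ]
    have : r ≠ 0 := (one_pos.trans hr.1).ne'
    field_simp
  s_map r hr θ := by
    simp only [amplitude_outer hμ2 hr.1 θ]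
    have : r ≠ 0 := (one_pos.trans hr.1).ne'
    have h2 := (angularSpeed_pos hμ2 hr.1 (r * Real.cos θ)).ne'
    field_simp
  map_periodic r θ := by simp only [Real.cos_add_two_pi, Real.sin_add_two_pi]
  map_eq p _ hI θ hc hs := by
    have h0 : amplitude μ p ≠ 0 := (one_pos.trans hI.1).ne'
    have h2 := (angularSpeed_pos hμ2 hI.1 p.1).ne'
    have e1 : amplitude μ p * Real.cos θ = p.1 := by rw [← hc]; field_simp
    rw [e1, ← hs]
    refine Prod.ext rfl ?_
    simp only
    field_simp
  Ω_pos r hr θ := by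
    simp only [zero_mul, add_zero, amplitude_outer hμ2 hr.1 θ]
    exact angularSpeed_pos hμ2 hr.1 _
  contDiff_A r hr θ ε := by
    have h1 := (contDiffAt_outer hμ2 hr.1 θ ε).fst
    have h3 : ContDiffAt ℝ 1 (fun p : ℝ × ℝ =>
        -(f.eval p.1 * p.2 ^ 2 / (amplitude μ p * (amplitude μ p ^ 2 - μ))))
        (r * Real.cos θ, -(r * Real.sin θ * angularSpeed μ r (r * Real.cos θ))) := by
      have h4 := amplitude_outer hμ2 hr.1 θ
      have h5 := contDiffAt_amplitude hμ hμ2 (h4.symm ▸ hr.1)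
      have h6 : ContDiff ℝ 1 fun p : ℝ × ℝ => f.eval p.1 := (contDiff_eval f).comp contDiff_fst
      refine (ContDiffAt.div (by fun_prop) (by fun_prop) ?_).neg
      rw [h4]
      have : 0 < r ^ 2 - μ := by nlinarith [hr.1]
      have : 0 < r := one_pos.trans hr.1
      positivity
    exact h3.comp (f := fun q : (ℝ × ℝ) × ℝ => ((q.1.2 * Real.cos q.2,
      -(q.1.2 * Real.sin q.2 * angularSpeed μ q.1.2 (q.1.2 * Real.cos q.2))) : ℝ × ℝ))
      ((ε, r), θ) h1
  contDiff_Ω r hr θ ε := by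
    have h1 := contDiffAt_outer hμ2 hr.1 θ ε
    have h3 : ContDiffAt ℝ 1 (fun z : (ℝ × ℝ) × ℝ => angularSpeed μ (amplitude μ z.1) z.1.1 +
        z.2 * (f.eval z.1.1 * z.1.1 * z.1.2 * angularSpeed μ (amplitude μ z.1) z.1.1 /
        (amplitude μ z.1 ^ 2 * (amplitude μ z.1 ^ 2 - μ))))
        ((r * Real.cos θ, -(r * Real.sin θ * angularSpeed μ r (r * Real.cos θ))), ε) := by
      have h4 := amplitude_outer hμ2 hr.1 θ
      have h5 : ContDiffAt ℝ 1 (fun z : (ℝ × ℝ) × ℝ => amplitude μ z.1)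
          ((r * Real.cos θ, -(r * Real.sin θ * angularSpeed μ r (r * Real.cos θ))), ε) :=
        ContDiffAt.comp (g := amplitude μ) _ (contDiffAt_amplitude hμ hμ2 (h4.symm ▸ hr.1))
          contDiffAt_fst
      have h6 : ContDiff ℝ 1 fun z : (ℝ × ℝ) × ℝ => f.eval z.1.1 :=
        (contDiff_eval f).comp (contDiff_fst.comp contDiff_fst)
      have h7 : ContDiffAt ℝ 1 (fun z : (ℝ × ℝ) × ℝ => angularSpeed μ (amplitude μ z.1) z.1.1)
          ((r * Real.cos θ, -(r * Real.sin θ * angularSpeed μ r (r * Real.cos θ))), ε) :=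
        ContDiffAt.sqrt (by fun_prop) (by
          rw [h4]; exact (angularSpeed_arg_pos hμ2 hr.1 _).ne')
      refine ContDiffAt.add h7 (contDiffAt_snd.mul (ContDiffAt.div (by fun_prop)
        (by fun_prop) ?_))
      rw [h4]
      have : 0 < r ^ 2 - μ := by nlinarith [hr.1]
      have : 0 < r := one_pos.trans hr.1
      positivity
    exact h3.comp (f := fun q : (ℝ × ℝ) × ℝ => (((q.1.2 * Real.cos q.2,
      -(q.1.2 * Real.sin q.2 * angularSpeed μ q.1.2 (q.1.2 * Real.cos q.2))), q.1.1) :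
      (ℝ × ℝ) × ℝ)) ((ε, r), θ) h1
  flow ε γ t _ hI hγ := by
    have ha0 : amplitude μ (γ t) ≠ 0 := (one_pos.trans hI.1).ne'
    have hρ : 0 < amplitude μ (γ t) ^ 2 - μ := by nlinarith [hI.1]
    have hR := duffingRadius_of_amplitude hμ (γ t)
    have hq0 := (angularSpeed_pos hμ2 hI.1 (γ t).1).ne'
    have hq := angularSpeed_sq hμ2 hI.1 (γ t).1
    have hy := sq_eq_of_amplitude hμ hμ2 hI.1
    have hr0 := hasDerivAt_duffingRadius hγ (hR ▸ hρ)
    have h1 : HasDerivAt (fun t => (γ t).1) (γ t).2 t := hγ.fst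
    have h2 : HasDerivAt (fun t => (γ t).2) _ t := hγ.snd
    have hr : HasDerivAt (fun t => amplitude μ (γ t)) (ε * -((f.eval (γ t).1) * (γ t).2 ^ 2 /
        (amplitude μ (γ t) * (amplitude μ (γ t) ^ 2 - μ)))) t := by
      refine (hr0.const_add μ |>.sqrt (by rw [hR]; nlinarith [hI.1])).congr_deriv ?_
      change _ / (2 * amplitude μ (γ t)) = _
      rw [hR]
      have := hρ.ne'
      field_simp
    refine ⟨hr, ?_, ?_⟩
    · refine (h1.fun_div hr ha0).congr_deriv ?_
      have hρ0 := hρ.ne'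
      set a := amplitude μ (γ t)
      set q := angularSpeed μ a (γ t).1
      field_simp
      ring
    · have h3 : HasDerivAt (fun t => angularSpeed μ (amplitude μ (γ t)) (γ t).1) _ t :=
        ((((h1.fun_pow 2).fun_add (hr.fun_pow 2)).sub_const (2 * μ)).div_const 2).sqrt
          (angularSpeed_arg_pos hμ2 hI.1 _).ne'
      refine (h2.fun_neg.fun_div (hr.fun_mul h3) (mul_ne_zero ha0 hq0)).congr_deriv ?_
      simp only [lienard, eval_duffing]
      have hρ0 := hρ.ne'
      change (_ * _ - _ * (_ * angularSpeed μ (amplitude μ (γ t)) (γ t).1 + _ * (_ / (2 *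
        angularSpeed μ (amplitude μ (γ t)) (γ t).1)))) / _ = _
      set a := amplitude μ (γ t)
      set q := angularSpeed μ a (γ t).1
      field_simp
      push_cast
      linear_combination (-4 * (ε * f.eval (γ t).1 * (γ t).2) * q ^ 2 + 2 * a ^ 2 *
        ((a ^ 2 - μ) * (γ t).1 - ε * f.eval (γ t).1 * (γ t).2)) * hy -
        4 * q ^ 2 * a ^ 2 * (ε * f.eval (γ t).1 * (γ t).2 + (γ t).1 * (a ^ 2 - μ)) * hq
  lift ε r θ t hI hr hθ := by
    have hR := amplitude_outer hμ2 hI.1 (θ t)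
    simp only [hR] at hr hθ
    have ha0 : r t ≠ 0 := (one_pos.trans hI.1).ne'
    have hρ : r t ^ 2 - μ ≠ 0 := by nlinarith [hI.1]
    have hq0 := (angularSpeed_pos hμ2 hI.1 (r t * Real.cos (θ t))).ne'
    have hq := angularSpeed_sq hμ2 hI.1 (r t * Real.cos (θ t))
    have h1 := hr.fun_mul hθ.cos
    have h3 : HasDerivAt (fun t => angularSpeed μ (r t) (r t * Real.cos (θ t))) _ t :=
        ((((h1.fun_pow 2).fun_add (hr.fun_pow 2)).sub_const (2 * μ)).div_const 2).sqrt
          (angularSpeed_arg_pos hμ2 hI.1 _).ne'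
    have h2 := ((hr.fun_mul hθ.sin).fun_mul h3).fun_neg
    refine (h1.prodMk h2).congr_deriv (Prod.ext ?_ ?_)
    · simp only [lienard]
      set q := angularSpeed μ (r t) (r t * Real.cos (θ t))
      field_simp
      ring
    · simp only [lienard, eval_duffing]
      change -(_ * angularSpeed μ (r t) (r t * Real.cos (θ t)) + _ * (_ / (2 *
        angularSpeed μ (r t) (r t * Real.cos (θ t))))) = _
      set q := angularSpeed μ (r t) (r t * Real.cos (θ t))
      field_simp
      push_cast
      linear_combination (4 * q ^ 3 * (ε * f.eval (r t * Real.cos (θ t))) * Real.sin (θ t) +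
        2 * r t ^ 2 * (ε * f.eval (r t * Real.cos (θ t))) * Real.sin (θ t) * q +
        2 * r t ^ 2 * Real.cos (θ t) * (r t ^ 2 - μ)) * Real.sin_sq_add_cos_sq (θ t) +
        (4 * (ε * f.eval (r t * Real.cos (θ t))) * Real.sin (θ t) * q -
        4 * Real.cos (θ t) * (r t ^ 2 - μ)) * hq

theorem exists_polynomial_moments {w : ℝ → ℝ} (hw : Continuous w) (h0 : ∀ θ, 0 ≤ w θ)
    (h1 : 0 < w (Real.pi / 4)) (Q : ℝ[X]) :
    ∃ P : ℝ[X], P.natDegree ≤ Q.natDegree ∧ ∀ r : ℝ,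
      ∫ θ in (0 : ℝ)..2 * Real.pi, P.eval ((r * Real.cos θ) ^ 2) * w θ = Q.eval (r ^ 2) := by
  have hπ := Real.pi_pos
  have hc (i : ℕ) : 0 < ∫ θ in (0 : ℝ)..2 * Real.pi, (Real.cos θ ^ 2) ^ i * w θ := by
    refine intervalIntegral.integral_pos (by positivity) (by fun_prop)
      (fun θ _ => mul_nonneg (by positivity) (h0 θ)) ⟨Real.pi / 4, ⟨by positivity, by linarith⟩, ?_⟩
    rw [Real.cos_pi_div_four]
    positivity
  refine ⟨∑ i ∈ Finset.range (Q.natDegree + 1), C (Q.coeff i /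
    ∫ θ in (0 : ℝ)..2 * Real.pi, (Real.cos θ ^ 2) ^ i * w θ) * X ^ i, ?_, fun r => ?_⟩
  · refine natDegree_sum_le_of_forall_le _ _ fun i hi => (natDegree_C_mul_X_pow_le _ _).trans ?_
    exact Nat.lt_succ_iff.1 (Finset.mem_range.1 hi)
  · simp only [eval_finsetSum, eval_mul, eval_C, eval_pow, eval_X, Finset.sum_mul]
    rw [intervalIntegral.integral_finsetSum fun i _ =>
      Continuous.intervalIntegrable (by fun_prop) _ _, eval_eq_sum_range]
    refine Finset.sum_congr rfl fun i _ => ?_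
    rw [show (fun θ => Q.coeff i / (∫ θ in (0 : ℝ)..2 * Real.pi, (Real.cos θ ^ 2) ^ i * w θ) *
        ((r * Real.cos θ) ^ 2) ^ i * w θ) = fun θ => Q.coeff i /
        (∫ θ in (0 : ℝ)..2 * Real.pi, (Real.cos θ ^ 2) ^ i * w θ) * (r ^ 2) ^ i *
        ((Real.cos θ ^ 2) ^ i * w θ) by funext θ; ring,
      intervalIntegral.integral_const_mul]
    have := (hc i).ne'
    field_simp

theorem exists_polynomial_simple_zeros {w : ℝ → ℝ} (hw : Continuous w) (h0 : ∀ θ, 0 ≤ w θ)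
    (h1 : 0 < w (Real.pi / 4)) {N : ℕ} {s : Fin N → ℝ} (hs : ∀ i, 0 < s i)
    (hinj : Function.Injective s) :
    ∃ P : ℝ[X], P.natDegree ≤ N ∧ ∀ i, ∃ d, d ≠ 0 ∧
      ∫ θ in (0 : ℝ)..2 * Real.pi, P.eval ((s i * Real.cos θ) ^ 2) * w θ = 0 ∧
      HasDerivAt (fun r => ∫ θ in (0 : ℝ)..2 * Real.pi, P.eval ((r * Real.cos θ) ^ 2) * w θ)
        d (s i) := by
  set Q : ℝ[X] := ∏ i, (X - C (s i ^ 2)) with hQ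
  have hsep : Q.Separable := separable_prod_X_sub_C_iff.2 fun i j hij =>
    hinj ((pow_left_inj₀ (hs i).le (hs j).le two_ne_zero).1 hij)
  have hroot (i) : Q.eval (s i ^ 2) = 0 := by
    rw [hQ, eval_prod]
    exact Finset.prod_eq_zero (Finset.mem_univ i) (by simp)
  obtain ⟨P, hP, hPQ⟩ := exists_polynomial_moments hw h0 h1 Q
  refine ⟨P, hP.trans (by rw [hQ, natDegree_finsetProd_X_sub_C_eq_card]; simp), fun i => ⟨Q.derivative.eval (s i ^ 2) * (2 * s i), ?_, ?_, ?_⟩⟩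
  · exact mul_ne_zero (hsep.eval₂_derivative_ne_zero (RingHom.id ℝ) (hroot i))
      (mul_pos two_pos (hs i)).ne'
  · rw [hPQ, hroot]
  · simp only [hPQ]
    have h2 : HasDerivAt (fun r : ℝ => r ^ 2) (2 * s i) (s i) := by simpa using hasDerivAt_pow 2 (s i)
    exact (Q.hasDerivAt (s i ^ 2)).comp (s i) h2

theorem intervalIntegral_eq_zero_of_antiperiodic {f : ℝ → ℝ} {c : ℝ}
    (hf : Function.Antiperiodic f c) : ∫ θ in (0 : ℝ)..2 * c, f θ = 0 := by
  have h1 := hf.periodic_two_mul.intervalIntegral_add_eq 0 c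
  have h2 := intervalIntegral.integral_comp_add_right (a := 0) (b := 2 * c) f c
  simp only [show ∀ θ, f (θ + c) = -f θ from hf, intervalIntegral.integral_neg] at h2
  rw [zero_add, add_comm c] at h1
  rw [zero_add] at h2
  linarith

/-- The damping polynomial `δ E(x²) + x P((x² - μ)²)`. -/
noncomputable def damping (E P : ℝ[X]) (μ δ : ℝ) : ℝ[X] :=
  C δ * E.comp (X ^ 2) + X * P.comp ((X ^ 2 - C μ) ^ 2)

theorem eval_damping (E P : ℝ[X]) (μ δ x : ℝ) :
    (damping E P μ δ).eval x = δ * E.eval (x ^ 2) + x * P.eval ((x ^ 2 - μ) ^ 2) := by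
  simp [damping]

theorem natDegree_damping_le {E P : ℝ[X]} {n : ℕ} (hE : 2 * E.natDegree ≤ n)
    (hP : 4 * P.natDegree + 1 ≤ n) (μ δ : ℝ) : (damping E P μ δ).natDegree ≤ n := by
  refine natDegree_add_le_of_degree_le ((natDegree_C_mul_le _ _).trans ?_)
    (natDegree_mul_le.trans ?_)
  · rw [natDegree_comp, natDegree_X_pow]; lia
  · rw [natDegree_comp, natDegree_pow, natDegree_X_pow_sub_C, natDegree_X]; lia

theorem wellChart_F (E P : ℝ[X]) {μ σ : ℝ} (hσ : σ ^ 2 = 1) (δ : ℝ) {r : ℝ} (hr : r ∈ Ioo 0 μ)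
    (θ : ℝ) : (wellChart (damping E P μ δ) (μ := μ) hσ).F ((0, r), θ) =
      -(σ * r / √2) * (P.eval ((r * Real.cos θ) ^ 2) * Real.sin θ ^ 2) -
      δ * (E.eval (μ + r * Real.cos θ) * r * Real.sin θ ^ 2 / (√2 * √(μ + r * Real.cos θ))) := by
  have hpos := well_arg_pos hr θ
  have hX := (Real.sqrt_pos.2 hpos).ne'
  have hX2 := Real.sq_sqrt hpos.le
  have h2 := sqrt_two_sq
  have h20 : √(2 : ℝ) ≠ 0 := by positivity
  have hr0 := hr.1.ne'
  have hσ0 : σ ≠ 0 := by rintro rfl; norm_num at hσ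
  simp only [PolarChart.F, wellChart, duffingRadius_well hσ hr, eval_damping, zero_mul, add_zero,
    mul_pow, hσ, hX2, one_mul, add_sub_cancel_left]
  field_simp
  rw [h2]
  ring

theorem exists_isLimitCycle_well (E P : ℝ[X]) {μ σ r d ζ : ℝ} (hσ : σ ^ 2 = 1) (hr : r ∈ Ioo 0 μ)
    (h0 : ∫ θ in (0 : ℝ)..2 * Real.pi, P.eval ((r * Real.cos θ) ^ 2) * Real.sin θ ^ 2 = 0)
    (hd : HasDerivAt (fun r => ∫ θ in (0 : ℝ)..2 * Real.pi,
      P.eval ((r * Real.cos θ) ^ 2) * Real.sin θ ^ 2) d r) (hd0 : d ≠ 0) (hζ : 0 < ζ) :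
    ∀ᶠ δ in 𝓝 (0 : ℝ), ∀ᶠ ε in 𝓝[>] (0 : ℝ), ∃ Γ,
      IsLimitCycle (lienard (damping E P μ δ) (X ^ 3 - C μ * X) ε) Γ ∧
      ∀ p ∈ Γ, 0 < σ * p.1 ∧ |duffingRadius μ p - r| < ζ := by
  set G : (ℝ × ℝ) × ℝ → ℝ := fun q =>
      -(σ * q.1.2 / √2) * (P.eval ((q.1.2 * Real.cos q.2) ^ 2) * Real.sin q.2 ^ 2) -
      q.1.1 * (E.eval (μ + q.1.2 * Real.cos q.2) * q.1.2 * Real.sin q.2 ^ 2 /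
        (√2 * √(μ + q.1.2 * Real.cos q.2))) with hGdef
  have h20 : √(2 : ℝ) ≠ 0 := by positivity
  have hr0 := hr.1.ne'
  have hσ0 : σ ≠ 0 := by rintro rfl; norm_num at hσ
  have hG : ∀ θ ∈ Icc 0 (2 * Real.pi), ContDiffAt ℝ 1 G ((0, r), θ) := fun θ _ => by
    have hpos := well_arg_pos hr θ
    have h1 : ContDiffAt ℝ 1 (fun q : (ℝ × ℝ) × ℝ => √(μ + q.1.2 * Real.cos q.2)) ((0, r), θ) :=
      ContDiffAt.sqrt (by fun_prop) hpos.ne'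
    have h2 : ContDiff ℝ 1 fun q : (ℝ × ℝ) × ℝ => P.eval ((q.1.2 * Real.cos q.2) ^ 2) :=
      (contDiff_eval P).comp (by fun_prop)
    have h3 : ContDiff ℝ 1 fun q : (ℝ × ℝ) × ℝ => E.eval (μ + q.1.2 * Real.cos q.2) :=
      (contDiff_eval E).comp (by fun_prop)
    have h4 : √2 * √(μ + r * Real.cos θ) ≠ 0 := mul_ne_zero h20 (Real.sqrt_pos.2 hpos).ne'
    refine ContDiffAt.sub (by fun_prop) (ContDiffAt.mul (by fun_prop)
      (ContDiffAt.div (by fun_prop) (by fun_prop) h4))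
  have hGint (x : ℝ) : ∫ θ in (0 : ℝ)..2 * Real.pi, G ((0, x), θ) = -(σ * x / √2) *
      ∫ θ in (0 : ℝ)..2 * Real.pi, P.eval ((x * Real.cos θ) ^ 2) * Real.sin θ ^ 2 := by
    simp only [hGdef, zero_mul, sub_zero]
    exact intervalIntegral.integral_const_mul _ _
  have hsimple := exists_simple_zero (F := G) (d := -(σ * r / √2) * d) Real.two_pi_pos.le hG
    (by rw [hGint, h0, mul_zero]) (by
      simp only [hGint]
      have h1 : HasDerivAt (fun x => -(σ * x / √2)) (-(σ * 1 / √2)) r :=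
        (((hasDerivAt_id r).const_mul σ).div_const √2).fun_neg
      refine (h1.fun_mul hd).congr_deriv ?_
      rw [h0]; ring) (by
      refine mul_ne_zero (neg_ne_zero.2 (div_ne_zero (mul_ne_zero hσ0 hr0) h20)) hd0)
    (η := min (ζ / 2) (min r (μ - r))) (by
      have := hr.1; have := sub_pos.2 hr.2; positivity)
  filter_upwards [hsimple] with δ ⟨r', hr', hz, d', hd', hD⟩
  have hr1 := abs_lt.1 ((hr'.trans_le (min_le_right _ _)).trans_le (min_le_left _ _))
  have hr2 := abs_lt.1 ((hr'.trans_le (min_le_right _ _)).trans_le (min_le_right _ _))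
  have hr3 := hr'.trans_le (min_le_left _ _)
  have hmem : r' ∈ Ioo 0 μ := ⟨by linarith, by linarith⟩
  have hF : ∀ x ∈ Ioo 0 μ, ∫ θ in (0 : ℝ)..2 * Real.pi,
      (wellChart (damping E P μ δ) (μ := μ) hσ).F ((0, x), θ) =
      ∫ θ in (0 : ℝ)..2 * Real.pi, G ((δ, x), θ) := fun x hx =>
    intervalIntegral.integral_congr fun θ _ => wellChart_F E P hσ δ hx θ
  have := (wellChart (damping E P μ δ) (μ := μ) hσ).eventually_exists_isLimitCycle hmem
    ((hF r' hmem).trans hz) (hD.congr_of_eventuallyEq (by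
      filter_upwards [Ioo_mem_nhds hmem.1 hmem.2] with x hx using hF x hx)) hd' (half_pos hζ)
  filter_upwards [this] with ε ⟨Γ, hΓ, h⟩
  refine ⟨Γ, hΓ, fun p hp => ⟨(h p hp).1, ?_⟩⟩
  have h5 := abs_lt.1 (h p hp).2
  have h6 := abs_lt.1 hr3
  exact abs_lt.2 ⟨by linarith, by linarith⟩

/-- The integrand of the averaged radial speed along the outer orbit of amplitude `a`. -/
noncomputable def outerIntegrand (E : ℝ[X]) (q : (ℝ × ℝ) × ℝ) : ℝ :=
  E.eval ((q.1.2 * Real.cos q.2) ^ 2) * q.1.2 * Real.sin q.2 ^ 2 *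
    angularSpeed q.1.1 q.1.2 (q.1.2 * Real.cos q.2) / (q.1.2 ^ 2 - q.1.1)

theorem eventually_exists_outer_zero (E : ℝ[X]) {a d η : ℝ} (ha : 1 < a)
    (h0 : ∫ θ in (0 : ℝ)..2 * Real.pi, E.eval ((a * Real.cos θ) ^ 2) *
      (Real.sin θ ^ 2 * √((Real.cos θ ^ 2 + 1) / 2)) = 0)
    (hd : HasDerivAt (fun a => ∫ θ in (0 : ℝ)..2 * Real.pi, E.eval ((a * Real.cos θ) ^ 2) *
      (Real.sin θ ^ 2 * √((Real.cos θ ^ 2 + 1) / 2))) d a) (hd0 : d ≠ 0) (hη : 0 < η) :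
    ∀ᶠ μ in 𝓝 (0 : ℝ), ∃ a', |a' - a| < η ∧
      ∫ θ in (0 : ℝ)..2 * Real.pi, outerIntegrand E ((μ, a'), θ) = 0 ∧ ∃ d', d' ≠ 0 ∧
      HasDerivAt (fun x => ∫ θ in (0 : ℝ)..2 * Real.pi, outerIntegrand E ((μ, x), θ)) d' a' := by
  have hbase : ∀ x > 0, ∫ θ in (0 : ℝ)..2 * Real.pi, outerIntegrand E ((0, x), θ) =
      ∫ θ in (0 : ℝ)..2 * Real.pi, E.eval ((x * Real.cos θ) ^ 2) *
        (Real.sin θ ^ 2 * √((Real.cos θ ^ 2 + 1) / 2)) := fun x hx => by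
    refine intervalIntegral.integral_congr fun θ _ => ?_
    have h1 : angularSpeed 0 x (x * Real.cos θ) = x * √((Real.cos θ ^ 2 + 1) / 2) := by
      unfold angularSpeed
      rw [← Real.sqrt_sq hx.le, ← Real.sqrt_mul (sq_nonneg x), Real.sqrt_sq hx.le]
      congr 1; ring
    simp only [outerIntegrand, h1]
    field_simp
    ring
  refine exists_simple_zero Real.two_pi_pos.le (fun θ _ => ?_)
    ((hbase a (by linarith)).trans h0) (hd.congr_of_eventuallyEq ?_) hd0 hη
  · have h1 : ContDiff ℝ 1 fun q : (ℝ × ℝ) × ℝ => E.eval ((q.1.2 * Real.cos q.2) ^ 2) :=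
      (contDiff_eval E).comp (by fun_prop)
    have h2 : ContDiffAt ℝ 1 (fun q : (ℝ × ℝ) × ℝ =>
        angularSpeed q.1.1 q.1.2 (q.1.2 * Real.cos q.2)) ((0, a), θ) :=
      ContDiffAt.sqrt (by fun_prop) (angularSpeed_arg_pos (by norm_num) ha _).ne'
    exact ContDiffAt.div (by fun_prop) (by fun_prop) (by simp only; nlinarith)
  · filter_upwards [Ioi_mem_nhds (one_pos.trans ha)] with x hx using hbase x hx

theorem integral_outerChart_F (E P : ℝ[X]) {μ : ℝ} (hμ : 0 ≤ μ) (hμ2 : μ ≤ 1 / 2) (δ : ℝ)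
    {a β : ℝ} (ha : a ∈ Ioo 1 β) :
    ∫ θ in (0 : ℝ)..2 * Real.pi, (outerChart (damping E P μ δ) hμ hμ2 β).F ((0, a), θ) =
      -δ * ∫ θ in (0 : ℝ)..2 * Real.pi, outerIntegrand E ((μ, a), θ) := by
  have hpos : 0 < a ^ 2 - μ := by nlinarith [ha.1]
  have ha0 : a ≠ 0 := (one_pos.trans ha.1).ne'
  set H : ℝ → ℝ := fun θ => a * Real.cos θ * P.eval (((a * Real.cos θ) ^ 2 - μ) ^ 2) * a *
    Real.sin θ ^ 2 * angularSpeed μ a (a * Real.cos θ) / (a ^ 2 - μ) with hH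
  have hodd : Function.Antiperiodic H Real.pi := fun θ => by
    simp only [hH, Real.cos_add_pi, Real.sin_add_pi, angularSpeed, mul_neg, neg_sq]
    ring
  have hF (θ : ℝ) : (outerChart (damping E P μ δ) hμ hμ2 β).F ((0, a), θ) =
      -δ * outerIntegrand E ((μ, a), θ) - H θ := by
    have hq := (angularSpeed_pos hμ2 ha.1 (a * Real.cos θ)).ne'
    simp only [PolarChart.F, outerChart, amplitude_outer hμ2 ha.1, eval_damping, zero_mul,
      add_zero, outerIntegrand, hH]
    set q := angularSpeed μ a (a * Real.cos θ)
    have := hpos.ne'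
    field_simp
    ring
  have hcq : Continuous fun θ => angularSpeed μ a (a * Real.cos θ) := by
    unfold angularSpeed; fun_prop
  have hcH : Continuous H := by fun_prop
  have hcO : Continuous fun θ => outerIntegrand E ((μ, a), θ) := by
    unfold outerIntegrand; simp only; fun_prop
  simp only [hF]
  rw [intervalIntegral.integral_sub ((hcO.const_mul _).intervalIntegrable _ _)
    (hcH.intervalIntegrable _ _), intervalIntegral.integral_const_mul,
    intervalIntegral_eq_zero_of_antiperiodic hodd, sub_zero]

theorem exists_isLimitCycle_outer (E P : ℝ[X]) {μ a d ζ δ : ℝ} (hμ : 0 ≤ μ) (hμ2 : μ ≤ 1 / 2)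
    (ha : 1 < a) (h0 : ∫ θ in (0 : ℝ)..2 * Real.pi, outerIntegrand E ((μ, a), θ) = 0)
    (hd : HasDerivAt (fun x => ∫ θ in (0 : ℝ)..2 * Real.pi, outerIntegrand E ((μ, x), θ)) d a)
    (hd0 : d ≠ 0) (hζ : 0 < ζ) (hδ : δ ≠ 0) :
    ∀ᶠ ε in 𝓝[>] (0 : ℝ), ∃ Γ,
      IsLimitCycle (lienard (damping E P μ δ) (X ^ 3 - C μ * X) ε) Γ ∧
      ∀ p ∈ Γ, |amplitude μ p - a| < ζ := by
  have hmem : a ∈ Ioo 1 (a + 1) := ⟨ha, by linarith⟩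
  have := (outerChart (damping E P μ δ) hμ hμ2 (a + 1)).eventually_exists_isLimitCycle hmem
    (by rw [integral_outerChart_F E P hμ hμ2 δ hmem, h0, mul_zero])
    ((hd.const_mul (-δ)).congr_of_eventuallyEq (by
      filter_upwards [Ioo_mem_nhds hmem.1 hmem.2] with x hx
        using integral_outerChart_F E P hμ hμ2 δ hx))
    (mul_ne_zero (neg_ne_zero.2 hδ) hd0) hζ
  filter_upwards [this] with ε ⟨Γ, hΓ, h⟩
  exact ⟨Γ, hΓ, fun p hp => (h p hp).2⟩

theorem IsPeriodicOrbit.nonempty {V : ℝ × ℝ → ℝ × ℝ} {Γ : Set (ℝ × ℝ)}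
    (h : IsPeriodicOrbit V Γ) : Γ.Nonempty := by
  obtain ⟨γ, -, -, -, rfl⟩ := h
  exact range_nonempty γ

theorem nat_eq_of_abs_sub_lt {c x : ℝ} (hc : 0 < c) {i j : ℕ}
    (hi : |x - (i + 1 / 2) * c| < c / 2) (hj : |x - (j + 1 / 2) * c| < c / 2) : i = j := by
  rw [abs_lt] at hi hj
  have h1 : (i : ℝ) < j + 1 := lt_of_mul_lt_mul_right (by linarith) hc.le
  have h2 : (j : ℝ) < i + 1 := lt_of_mul_lt_mul_right (by linarith) hc.le
  norm_cast at h1 h2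
  lia

theorem exists_damping_limitCycles (m K : ℕ) :
    ∃ (E P : ℝ[X]) (μ δ : ℝ), E.natDegree ≤ m ∧ P.natDegree ≤ K ∧
      ∃ ε₀ : ℝ, 0 < ε₀ ∧ ∀ ε : ℝ, 0 < ε → ε ≤ ε₀ → ∃ S : Finset (Set (ℝ × ℝ)),
        (∀ Γ ∈ S, IsLimitCycle (lienard (damping E P μ δ) (X ^ 3 - C μ * X) ε) Γ) ∧
        S.card = 2 * K + m := by
  have hsin : 0 < Real.sin (Real.pi / 4) := by rw [Real.sin_pi_div_four]; positivity
  obtain ⟨E, hEdeg, hE⟩ := exists_polynomial_simple_zeros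
    (w := fun θ => Real.sin θ ^ 2 * √((Real.cos θ ^ 2 + 1) / 2)) (by fun_prop)
    (fun θ => by positivity) (by positivity) (s := fun j : Fin m => (j : ℝ) + 3 / 2)
    (fun j => by positivity) (fun i j hij => Fin.ext (by simpa using hij))
  have hev : ∀ᶠ μ in 𝓝 (0 : ℝ), ∀ j : Fin m, ∃ a', |a' - ((j : ℝ) + 3 / 2)| < 1 / 4 ∧
      ∫ θ in (0 : ℝ)..2 * Real.pi, outerIntegrand E ((μ, a'), θ) = 0 ∧ ∃ d', d' ≠ 0 ∧
      HasDerivAt (fun x => ∫ θ in (0 : ℝ)..2 * Real.pi, outerIntegrand E ((μ, x), θ)) d' a' := by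
    refine eventually_all.2 fun j => ?_
    obtain ⟨d, hd0, h0, hd⟩ := hE j
    have : (0 : ℝ) ≤ (j : ℕ) := Nat.cast_nonneg _
    exact eventually_exists_outer_zero E (by linarith) h0 hd hd0 (by norm_num)
  obtain ⟨μ, hμev, hμ⟩ := ((hev.filter_mono nhdsWithin_le_nhds).and
    (Ioo_mem_nhdsGT (show (0 : ℝ) < 1 / 2 by norm_num))).exists
  choose a ha hza d hd0 hd using hμev
  set c : ℝ := μ / (K + 1) with hc
  have hμ0 : 0 < μ := hμ.1
  have hc0 : 0 < c := by positivity
  have hcK : (K + 1) * c = μ := by rw [hc]; field_simp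
  have hwell (i : Fin K) : (((i : ℕ) : ℝ) + 1) * c ≤ K * c :=
    mul_le_mul_of_nonneg_right (by exact_mod_cast i.2) hc0.le
  obtain ⟨P, hPdeg, hP⟩ := exists_polynomial_simple_zeros (w := fun θ => Real.sin θ ^ 2)
    (by fun_prop) (fun θ => by positivity) (by positivity)
    (s := fun i : Fin K => ((i : ℝ) + 1 / 2) * c) (fun i => by positivity)
    (fun i j hij => Fin.ext (by simpa [hc0.ne'] using hij))
  set σ : Bool → ℝ := fun b => if b then 1 else -1
  have hσ (b) : σ b ^ 2 = 1 := by cases b <;> simp [σ]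
  have hev : ∀ᶠ δ in 𝓝 (0 : ℝ), ∀ x : Bool × Fin K, ∀ᶠ ε in 𝓝[>] (0 : ℝ), ∃ Γ,
      IsLimitCycle (lienard (damping E P μ δ) (X ^ 3 - C μ * X) ε) Γ ∧
      ∀ p ∈ Γ, 0 < σ x.1 * p.1 ∧ |duffingRadius μ p - ((x.2 : ℝ) + 1 / 2) * c| < c / 2 := by
    refine eventually_all.2 fun x => ?_
    obtain ⟨d, hd0, h0, hd⟩ := hP x.2
    exact exists_isLimitCycle_well E P (hσ x.1) ⟨by positivity, by linarith [hwell x.2]⟩ h0 hd hd0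
      (half_pos hc0)
  obtain ⟨δ, hδev, hδ⟩ := ((hev.filter_mono nhdsWithin_le_nhds).and
    (self_mem_nhdsWithin (a := (0 : ℝ)) (s := Ioi 0))).exists
  refine ⟨E, P, μ, δ, hEdeg, hPdeg, ?_⟩
  have hevL := eventually_all.2 hδev
  have hevR := eventually_all.2 fun j => exists_isLimitCycle_outer E P hμ.1.le hμ.2.le
    (by linarith [(abs_lt.1 (ha j)).1, (Nat.cast_nonneg j : (0 : ℝ) ≤ (j : ℕ))]) (hza j) (hd j)
    (hd0 j) (show (0 : ℝ) < 1 / 4 by norm_num) (ne_of_gt hδ)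
  obtain ⟨ε₀, hε₀, hsub⟩ := mem_nhdsGT_iff_exists_Ioc_subset.1 (hevL.and hevR)
  refine ⟨ε₀, hε₀, fun ε h1 h2 => ?_⟩
  obtain ⟨hL, hR⟩ := hsub ⟨h1, h2⟩
  choose ΓL hΓL hmL using hL
  choose ΓR hΓR hmR using hR
  have hinjL : Function.Injective ΓL := fun x y hxy => by
    obtain ⟨p, hp⟩ := (hΓL x).1.nonempty
    obtain ⟨h3, h4⟩ := hmL x p hp
    obtain ⟨h5, h6⟩ := hmL y p (hxy ▸ hp)
    refine Prod.ext ?_ (Fin.ext (nat_eq_of_abs_sub_lt hc0 h4 h6))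
    generalize x.1 = b at h3
    generalize y.1 = b' at h5
    cases b <;> cases b' <;> simp [σ] at h3 h5 ⊢ <;> linarith
  have hinjR : Function.Injective ΓR := fun i j hij => by
    obtain ⟨p, hp⟩ := (hΓR i).1.nonempty
    have h3 := abs_lt.1 (hmR i p hp)
    have h4 := abs_lt.1 (hmR j p (hij ▸ hp))
    have h5 := abs_lt.1 (ha i)
    have h6 := abs_lt.1 (ha j)
    exact Fin.ext (nat_eq_of_abs_sub_lt (c := 1) (x := amplitude μ p - 1) one_pos
      (abs_lt.2 ⟨by linarith, by linarith⟩) (abs_lt.2 ⟨by linarith, by linarith⟩))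
  have hne (x j) : ΓL x ≠ ΓR j := fun hxj => by
    obtain ⟨p, hp⟩ := (hΓL x).1.nonempty
    have h3 := abs_lt.1 (hmL x p hp).2
    have h4 := abs_lt.1 (hmR j p (hxj ▸ hp))
    have h5 := abs_lt.1 (ha j)
    have h6 := duffingRadius_of_amplitude hμ0.le p
    have h7 : (0 : ℝ) ≤ (j : ℕ) := Nat.cast_nonneg _
    nlinarith [hwell x.2, hμ.2]
  have hinj : Function.Injective (Sum.elim ΓL ΓR) := hinjL.sumElim hinjR hne
  refine ⟨Finset.univ.map ⟨_, hinj⟩, fun Γ hΓ => ?_, by simp⟩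
  obtain ⟨x, -, rfl⟩ := Finset.mem_map.1 hΓ
  cases x with
  | inl x => exact hΓL x
  | inr j => exact hΓR j

end AveragingMethod

theorem stmt0 (n : ℕ) (hn : 3 ≤ n) :
    HGe n 3 ((2 * ((n - 1) / 4) + (n - 1) / 2 : ℕ) : ℝ) ∧
    HGe n 4 ((2 * ((n - 1) / 4) + (n - 1) / 2 : ℕ) : ℝ) := by
  obtain ⟨E, P, μ, δ, hE, hP, ε₀, hε₀, h⟩ :=
    exists_damping_limitCycles ((n - 1) / 2) ((n - 1) / 4)
  have hf := natDegree_damping_le (E := E) (P := P) (n := n) (by lia) (by lia) μ δ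
  have hg : (X ^ 3 - C μ * X : ℝ[X]).natDegree ≤ 3 :=
    (natDegree_sub_le _ _).trans (max_le (natDegree_X_pow_le 3)
      (((natDegree_C_mul_le _ _).trans natDegree_X_le).trans (by norm_num)))
  have hS : ∀ ε : ℝ, 0 < ε → ε ≤ ε₀ → ∃ S : Finset (Set (ℝ × ℝ)),
      (∀ Γ ∈ S, IsLimitCycle (lienard (damping E P μ δ) (X ^ 3 - C μ * X) ε) Γ) ∧
      ((2 * ((n - 1) / 4) + (n - 1) / 2 : ℕ) : ℝ) ≤ (S.card : ℝ) := fun ε h1 h2 => by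
    obtain ⟨S, hS, hcard⟩ := h ε h1 h2
    exact ⟨S, hS, by rw [hcard]⟩
  exact ⟨⟨_, _, hf, hg, ε₀, hε₀, hS⟩, ⟨_, _, hf, hg.trans (by norm_num), ε₀, hε₀, hS⟩⟩
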